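/- arXiv:1901.02632 — 2 statements merged into one kernel-verified Lean document; each statement's English description precedes it below -/
import Mathlib

section
/- Let K be a field, π ∈ K^× and e ≥ 1, and let R_π^e(K) = ⋂_{v ∈ S_π^e(K)} O_v be the holomorphy ring of S_π^e(K). Then the following are equivalent: (1) for every v ∈ S_π^e(K), R_π^e(K) is dense in O_v in the v-topology, i.e. for every y ∈ O_v and every z ∈ K^× there exists x ∈ R_π^e(K) with x − y ∈ z·m_v; (2) the elements of S_π^e(K) are pairwise independent, i.e. for any two distinct v_1, v_2 ∈ S_π^e(K), the only valuation ring of K containing both O_{v_1} and O_{v_2} is K itself. -/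
namespace PaperApprox

variable {K : Type*} [Field K]

/-- The "maximal ideal" `m_O = O \ O^×` of a ball `O`, where `O^× = O ∩ O⁻¹` and
`O⁻¹ = {x⁻¹ : 0 ≠ x ∈ O} = {x | x ≠ 0 ∧ x⁻¹ ∈ O}`. -/
def mball (O : Set K) : Set K := O \ (O ∩ {x | x ≠ 0 ∧ x⁻¹ ∈ O})

/-- The scaled set `z·S`. -/
def scale (z : K) (S : Set K) : Set K := {y | ∃ s ∈ S, y = z * s}

/-- A positive cone of a field ordering. -/
def IsOrderingCone (P : Set K) : Prop :=
  (∀ a ∈ P, ∀ b ∈ P, a + b ∈ P) ∧ (∀ a ∈ P, ∀ b ∈ P, a * b ∈ P) ∧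
    (∀ x : K, x ∈ P ∨ -x ∈ P) ∧ ∀ x : K, x ∈ P → -x ∈ P → x = 0

/-- `x ≤_P y` for a positive cone `P`. -/
def coneLE (P : Set K) (a b : K) : Prop := b - a ∈ P

/-- `x <_P y` for a positive cone `P`. -/
def coneLT (P : Set K) (a b : K) : Prop := b - a ∈ P ∧ a ≠ b

/-- The unit interval `{x : -1 ≤_P x ≤_P 1}` of an ordering. -/
def orderingBall (P : Set K) : Set K := {x | x + 1 ∈ P ∧ 1 - x ∈ P}

/-- `O` is the valuation ring of a (Krull) valuation on `K`. -/
def IsValuationLocality (O : Set K) : Prop := ∃ A : ValuationSubring K, O = (A : Set K)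

/-- `O` is the unit interval of a field ordering of `K`. -/
def IsOrderingLocality (O : Set K) : Prop := ∃ P : Set K, IsOrderingCone P ∧ O = orderingBall P

/-- `O` is the closed unit ball of an absolute value on `K`. -/
def IsAbsLocality (O : Set K) : Prop := ∃ f : AbsoluteValue K ℝ, O = {x | f x ≤ 1}

/-- A locality on `K`, identified with its ring/ball `O`. -/
def IsLocality (O : Set K) : Prop := IsValuationLocality O ∨ IsOrderingLocality O ∨ IsAbsLocality O

/-- `W` is the finest common coarsening of the localities `O₁`, `O₂`. -/
def IsFCC (O₁ O₂ W : Set K) : Prop :=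
  IsLocality W ∧ O₁ ⊆ W ∧ O₂ ⊆ W ∧ ∀ W', IsLocality W' → O₁ ⊆ W' → O₂ ⊆ W' → W ⊆ W'

/-- Two subsets `A`, `B` of `W` have the same image in the residue field `W/m_W`. -/
def SameResidue (W A B : Set K) : Prop :=
  (∀ x ∈ A, ∃ y ∈ B, x - y ∈ mball W) ∧ ∀ y ∈ B, ∃ x ∈ A, x - y ∈ mball W

/-- Incomparability of localities. -/
def Incomp (O₁ O₂ : Set K) : Prop := ¬O₁ ⊆ O₂ ∧ ¬O₂ ⊆ O₁

/-- Strong incomparability: incomparable, and the induced localities on the residue field of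
the finest common coarsening are distinct (their rings, i.e. the images of `O₁` and `O₂`,
differ). -/
def StronglyIncomp (O₁ O₂ : Set K) : Prop :=
  Incomp O₁ O₂ ∧ ∀ W, IsFCC O₁ O₂ W → ¬SameResidue W O₁ O₂

/-- `t`-independence of localities. -/
def TIndep (t : K) (O₁ O₂ : Set K) : Prop :=
  (∀ W, IsFCC O₁ O₂ W → t ∈ W ∧ t⁻¹ ∈ W) ∧
    (IsOrderingLocality O₁ → IsOrderingLocality O₂ → StronglyIncomp O₁ O₂)

/-- `t`-independence of valuation rings: `t` and `t⁻¹` lie in the smallest valuation ring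
containing both. -/
def TIndepVal (t : K) (O₁ O₂ : Set K) : Prop :=
  ∀ W : Set K, IsValuationLocality W → O₁ ⊆ W → O₂ ⊆ W →
    (∀ W', IsValuationLocality W' → O₁ ⊆ W' → O₂ ⊆ W' → W ⊆ W') → t ∈ W ∧ t⁻¹ ∈ W

/-- `t`-independence of sets of localities. -/
def SetTIndep (t : K) (S₁ S₂ : Set (Set K)) : Prop := ∀ v ∈ S₁, ∀ w ∈ S₂, TIndep t v w

/-- Incomparability of sets of localities. -/
def SetIncomp (S₁ S₂ : Set (Set K)) : Prop := ∀ v ∈ S₁, ∀ w ∈ S₂, Incomp v w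

/-- Independence of localities: the field topologies they induce on `K` (with the sets
`z·m_v`, `z ∈ K^×`, as neighbourhood bases of `0`) are distinct. -/
def IndepLoc (O₁ O₂ : Set K) : Prop :=
  ¬((∀ z : K, z ≠ 0 → ∃ z' : K, z' ≠ 0 ∧ scale z' (mball O₂) ⊆ scale z (mball O₁)) ∧
     ∀ z : K, z ≠ 0 → ∃ z' : K, z' ≠ 0 ∧ scale z' (mball O₁) ⊆ scale z (mball O₂))

/-- The Zariski topology on localities/balls of `K`. -/
def zarTop (K : Type*) [Field K] : TopologicalSpace (Set K) :=
  TopologicalSpace.generateFrom {U | ∃ x : K, U = {O : Set K | x ∈ O}}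

/-- The Hochster dual of the Zariski topology. -/
def zarStarTop (K : Type*) [Field K] : TopologicalSpace (Set K) :=
  TopologicalSpace.generateFrom {U | ∃ x : K, U = {O : Set K | x ∈ mball O}}

/-- The constructible topology. -/
def conTop (K : Type*) [Field K] : TopologicalSpace (Set K) :=
  TopologicalSpace.generateFrom
    ({U | ∃ x : K, U = {O : Set K | x ∈ O}} ∪ {U | ∃ x : K, U = {O : Set K | x ∈ mball O}})

/-- The Harrison topology on orderings (positive cones) of `K`. -/
def harrisonTop (K : Type*) [Field K] : TopologicalSpace (Set K) :=
  TopologicalSpace.generateFrom {U | ∃ x : K, x ≠ 0 ∧ U = {P : Set K | x ∈ P}}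

/-- Condition (i): `f(O) ⊆ O`. -/
def CondI (f : Polynomial K) (O : Set K) : Prop := ∀ x ∈ O, f.eval x ∈ O

/-- Condition (ii): `f(x) ∉ t·m_O` for `x ∈ O`. -/
def CondII (t : K) (f : Polynomial K) (O : Set K) : Prop := ∀ x ∈ O, f.eval x ∉ scale t (mball O)

/-- Condition (iii): `f(x) ∈ x^d (O \ t·m_O) ∩ (a_d x^d + x^(d-1) O)` for `x ∉ O`. -/
def CondIII (t : K) (f : Polynomial K) (O : Set K) : Prop :=
  ∀ x : K, x ∉ O →
    f.eval x ∈ scale (x ^ f.natDegree) (O \ scale t (mball O)) ∧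
      ∃ u ∈ O, f.eval x = f.leadingCoeff * x ^ f.natDegree + x ^ (f.natDegree - 1) * u

/-- Condition (iv): `O + O ⊆ t⁻¹·O`. -/
def CondIV (t : K) (O : Set K) : Prop := ∀ a ∈ O, ∀ b ∈ O, a + b ∈ scale t⁻¹ O

/-- Assumption (U) for a set `S` of localities and `t ∈ K^×`. -/
def AssumptionU (S : Set (Set K)) (t : K) : Prop :=
  ∃ f : Polynomial K, 2 ≤ f.natDegree ∧
    ∀ v ∈ S, CondI f v ∧ CondII t f v ∧ CondIII t f v ∧ CondIV t v

/-- Assumption (U-exc) for finitely many sets `S 1, …, S n` of localities and `t ∈ K^×`: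
conditions (i), (iii), (iv) everywhere, and condition (ii) on the infinite `S i`. -/
def AssumptionUExc {n : ℕ} (S : Fin n → Set (Set K)) (t : K) : Prop :=
  ∃ f : Polynomial K, 2 ≤ f.natDegree ∧
    (∀ i, ∀ v ∈ S i, CondI f v ∧ CondIII t f v ∧ CondIV t v) ∧
      ∀ i, (S i).Infinite → ∀ v ∈ S i, CondII t f v

/-- `S_π^e(K)`: valuation rings whose value group has a smallest positive element `γ`
(multiplicatively: a largest element `γ < 1`), such that `ℤγ` is convex and
`0 < v(π) ≤ eγ` (multiplicatively `γ^e ≤ v(π) < 1`). -/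
def SPiE (π : K) (e : ℕ) : Set (Set K) :=
  {O | ∃ A : ValuationSubring K, O = (A : Set K) ∧
    ∃ γ : A.ValueGroup, γ ≠ 0 ∧ γ < 1 ∧
      (∀ δ : A.ValueGroup, δ ≠ 0 → δ < 1 → δ ≤ γ) ∧
      (∀ δ : A.ValueGroup, δ ≠ 0 → ∀ m n : ℤ, γ ^ m ≤ δ → δ ≤ γ ^ n → ∃ k : ℤ, δ = γ ^ k) ∧
      A.valuation π < 1 ∧ γ ^ e ≤ A.valuation π}

/-- `O_w` is convex with respect to the ordering with positive cone `P`. -/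
def ConvexWrtOrdering (P W : Set K) : Prop :=
  ∀ u w : K, u ∈ P → w - u ∈ P → w ∈ W → u ∈ W

/-- Iterated application `φ(x₁, φ(x₂, …))`. -/
def iterPhi (φ : K → K → K) : K → List K → K
  | x, [] => x
  | x, y :: l => φ x (iterPhi φ y l)

/-- First-order characterization condition. -/
def CC (π : K) (e : ℕ) (A : ValuationSubring K) : Prop :=
  A.valuation π < 1 ∧ ∀ x, 1 < A.valuation x → 1 < A.valuation π * A.valuation x ^ (e + 1)

lemma exists_chain {Γ : Type*} [LinearOrderedCommGroupWithZero Γ] (p : Γ) (hp0 : p ≠ 0)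
    (hp : p < 1) (H : ∀ g : Γ, g ≠ 0 → g < 1 → ∃ d, d ≠ 0 ∧ d < 1 ∧ g < d) (n : ℕ) :
    ∃ g, 1 < g ∧ p * g ^ (n + 1) ≤ 1 := by
  induction n with
  | zero => exact ⟨p⁻¹, (one_lt_inv₀ (zero_lt_iff.2 hp0)).2 hp, by simp [hp0]⟩
  | succ n ih =>
    obtain ⟨g, hg, hpg⟩ := ih
    have hg0 : g ≠ 0 := (zero_lt_one.trans hg).ne'
    obtain ⟨d, hd0, hd1, hd⟩ := H g⁻¹ (inv_ne_zero hg0) (inv_lt_one_of_one_lt₀ hg)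
    have hr : 1 < d⁻¹ := (one_lt_inv₀ (zero_lt_iff.2 hd0)).2 hd1
    have hs : 1 < g * d := by
      have := mul_lt_mul_of_pos_left hd (zero_lt_iff.2 hg0)
      rwa [mul_inv_cancel₀ hg0] at this
    refine ⟨min d⁻¹ (g * d), lt_min hr hs, ?_⟩
    set h := min d⁻¹ (g * d)
    have h1 : 1 < h := lt_min hr hs
    have hh : h * h ≤ g := by
      calc h * h ≤ d⁻¹ * (g * d) := mul_le_mul' (min_le_left _ _) (min_le_right _ _)
        _ = g := by field_simp
    calc p * h ^ (n + 1 + 1) ≤ p * h ^ (2 * (n + 1)) := by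
          apply mul_le_mul_right
          exact pow_le_pow_right₀ h1.le (by omega)
      _ = p * (h * h) ^ (n + 1) := by rw [pow_mul, sq]
      _ ≤ p * g ^ (n + 1) := by
          apply mul_le_mul_right
          exact pow_le_pow_left₀ zero_le' hh _
      _ ≤ 1 := hpg

lemma convex_of_max {Γ : Type*} [LinearOrderedCommGroupWithZero Γ] (γ : Γ) (h0 : γ ≠ 0)
    (h1 : γ < 1) (H : ∀ δ : Γ, δ ≠ 0 → δ < 1 → δ ≤ γ) (δ : Γ) (hδ : δ ≠ 0) (m n : ℤ)
    (hm : γ ^ m ≤ δ) (hn : δ ≤ γ ^ n) : ∃ k : ℤ, δ = γ ^ k := by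
  have hpos := zero_lt_iff.2 h0
  obtain ⟨k, hk, hmax⟩ := Int.exists_greatest_of_bdd (P := fun k => δ ≤ γ ^ k)
    ⟨m, fun z hz => by
      by_contra hlt
      push Not at hlt
      have := zpow_lt_zpow_right_of_lt_one₀ hpos h1 hlt
      exact absurd (hm.trans hz) (not_le.2 this)⟩ ⟨n, hn⟩
  refine ⟨k, le_antisymm hk ?_⟩
  by_contra hlt
  push Not at hlt
  have hkpos : 0 < γ ^ k := zpow_pos hpos k
  have h2 : δ / γ ^ k ≤ γ := H _ (div_ne_zero hδ hkpos.ne') ((div_lt_one₀ hkpos).2 hlt)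
  rw [div_le_iff₀ hkpos] at h2
  have := hmax (k + 1) (by rw [zpow_add_one₀ h0, mul_comm]; exact h2)
  omega

lemma mem_SPiE_iff {π : K} (hπ : π ≠ 0) (e : ℕ) (A : ValuationSubring K) :
    (A : Set K) ∈ SPiE π e ↔ CC π e A := by
  constructor
  · rintro ⟨B, hB, γ, h0, h1, hmax, -, hp1, hp⟩
    obtain rfl : A = B := SetLike.coe_injective hB
    refine ⟨hp1, fun x hx => ?_⟩
    have hx0 : A.valuation x ≠ 0 := (zero_lt_one.trans hx).ne'
    have hpos := zero_lt_iff.2 h0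
    have h2 : (A.valuation x)⁻¹ ≤ γ := hmax _ (inv_ne_zero hx0) (inv_lt_one_of_one_lt₀ hx)
    have h3 : γ⁻¹ ≤ A.valuation x := inv_le_of_inv_le₀ (zero_lt_iff.2 hx0) h2
    calc 1 < γ⁻¹ := (one_lt_inv₀ hpos).2 h1
      _ = γ ^ e * γ⁻¹ ^ (e + 1) := by rw [pow_succ, ← mul_assoc, ← mul_pow]; simp [h0]
      _ ≤ _ := mul_le_mul' hp (pow_le_pow_left₀ zero_le' h3 _)
  · rintro ⟨hp1, H⟩
    have hp0 : A.valuation π ≠ 0 := by simpa using hπ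
    have key : ∃ γ : A.ValueGroup, γ ≠ 0 ∧ γ < 1 ∧ ∀ δ : A.ValueGroup, δ ≠ 0 → δ < 1 → δ ≤ γ := by
      by_contra hcon
      push Not at hcon
      obtain ⟨g, hg1, hg⟩ := exists_chain (A.valuation π) hp0 hp1 hcon e
      obtain ⟨x, rfl⟩ := A.valuation_surjective g
      exact absurd (H x hg1) (not_lt.2 hg)
    obtain ⟨γ, h0, h1, hmax⟩ := key
    have hpos := zero_lt_iff.2 h0
    refine ⟨A, rfl, γ, h0, h1, hmax, convex_of_max γ h0 h1 hmax, hp1, ?_⟩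
    by_contra hlt
    push Not at hlt
    have hγe : 0 < γ ^ e := pow_pos hpos e
    have h2 := hmax _ (div_ne_zero hp0 hγe.ne') ((div_lt_one₀ hγe).2 hlt)
    rw [div_le_iff₀ hγe, ← pow_succ'] at h2
    obtain ⟨x, hx⟩ := A.valuation_surjective γ⁻¹
    have h3 := H x (by rw [hx]; exact (one_lt_inv₀ hpos).2 h1)
    rw [hx] at h3
    have h4 : A.valuation π * γ⁻¹ ^ (e + 1) ≤ γ ^ (e + 1) * γ⁻¹ ^ (e + 1) :=
      mul_le_mul_left h2 _
    rw [← mul_pow, mul_inv_cancel₀ h0, one_pow] at h4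
    exact absurd h3 (not_lt.2 h4)

lemma mem_mball_iff (A : ValuationSubring K) (x : K) :
    x ∈ mball (A : Set K) ↔ A.valuation x < 1 := by
  simp only [mball, Set.mem_diff, Set.mem_inter_iff, Set.mem_setOf_eq, SetLike.mem_coe,
    ← A.valuation_le_one_iff, map_inv₀]
  by_cases hx : x = 0
  · simp [hx]
  · have : 0 < A.valuation x := zero_lt_iff.2 (by simpa using hx)
    rw [inv_le_one₀ this]
    constructor
    · rintro ⟨h1, h2⟩
      by_contra h
      exact h2 ⟨h1, hx, not_lt.1 h⟩
    · intro h
      exact ⟨h.le, fun h2 => absurd h2.2.2 (not_le.2 h)⟩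

lemma mem_scale_iff (A : ValuationSubring K) {z : K} (hz : z ≠ 0) (x : K) :
    x ∈ scale z (mball (A : Set K)) ↔ A.valuation x < A.valuation z := by
  have hz' : 0 < A.valuation z := zero_lt_iff.2 (by simpa using hz)
  constructor
  · rintro ⟨s, hs, rfl⟩
    rw [mem_mball_iff] at hs
    rw [map_mul]
    simpa using mul_lt_mul_of_pos_left hs hz'
  · intro h
    refine ⟨x / z, ?_, by field_simp⟩
    rw [mem_mball_iff, map_div₀]
    exact (div_lt_one₀ hz').2 h

/-- The product of two valuation rings. -/
def prodRing (A B : ValuationSubring K) : ValuationSubring K where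
  carrier := {x | ∃ a ∈ A, ∃ b ∈ B, x = a * b}
  mul_mem' := by
    rintro _ _ ⟨a, ha, b, hb, rfl⟩ ⟨a', ha', b', hb', rfl⟩
    exact ⟨a * a', A.mul_mem _ _ ha ha', b * b', B.mul_mem _ _ hb hb', by ring⟩
  one_mem' := ⟨1, A.one_mem, 1, B.one_mem, by ring⟩
  zero_mem' := ⟨0, A.zero_mem, 0, B.zero_mem, by ring⟩
  neg_mem' := by
    rintro _ ⟨a, ha, b, hb, rfl⟩
    exact ⟨-a, A.neg_mem _ ha, b, hb, by ring⟩
  add_mem' := by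
    rintro _ _ ⟨a, ha, b, hb, rfl⟩ ⟨a', ha', b', hb', rfl⟩
    by_cases h : b = 0
    · exact ⟨a', ha', b', hb', by simp [h]⟩
    by_cases h' : b' = 0
    · exact ⟨a, ha, b, hb, by simp [h']⟩
    rcases A.mem_or_inv_mem (b / b') with h1 | h1
    · exact ⟨a * (b / b') + a', A.add_mem _ _ (A.mul_mem _ _ ha h1) ha', b', hb', by
        field_simp⟩
    · rw [inv_div] at h1
      exact ⟨a + a' * (b' / b), A.add_mem _ _ ha (A.mul_mem _ _ ha' h1), b, hb, by
        field_simp⟩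
  mem_or_inv_mem' := by
    intro x
    rcases A.mem_or_inv_mem x with h | h
    · exact Or.inl ⟨x, h, 1, B.one_mem, by ring⟩
    · exact Or.inr ⟨x⁻¹, h, 1, B.one_mem, by ring⟩

lemma CC.small {π : K} {e : ℕ} {A : ValuationSubring K} (h : CC π e A)
    (hπ : π ≠ 0) {c : K} (hc : A.valuation c < 1) :
    A.valuation (π + c ^ (e + 1)) = A.valuation π := by
  apply Valuation.map_add_eq_of_lt_left
  by_cases hc0 : c = 0
  · simpa [hc0, zero_lt_iff] using hπ
  have hc' : 0 < A.valuation c := zero_lt_iff.2 (by simpa using hc0)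
  have := h.2 c⁻¹ (by rw [map_inv₀]; exact (one_lt_inv₀ hc').2 hc)
  rw [map_inv₀, inv_pow, ← div_eq_mul_inv, one_lt_div₀ (pow_pos hc' _)] at this
  rwa [map_pow]

lemma CC.large {π : K} {e : ℕ} {A : ValuationSubring K} (h : CC π e A)
    {c : K} (hc : 1 ≤ A.valuation c) :
    A.valuation (π + c ^ (e + 1)) = A.valuation c ^ (e + 1) := by
  rw [← map_pow]
  apply Valuation.map_add_eq_of_lt_right
  rw [map_pow]
  exact h.1.trans_le (one_le_pow₀ hc)

lemma CC.integral {π : K} {e : ℕ} {A : ValuationSubring K} (h : CC π e A)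
    (hπ : π ≠ 0) (c : K) : π / (π + c ^ (e + 1)) ∈ A := by
  rw [← A.valuation_le_one_iff, map_div₀]
  rcases lt_or_ge (A.valuation c) 1 with hc | hc
  · rw [h.small hπ hc]
    exact div_self_le_one _
  · rw [h.large hc]
    exact div_le_one_of_le₀ (h.1.le.trans (one_le_pow₀ hc)) zero_le'

/-- separation of two independent valuations -/
lemma separate {π : K} (hπ : π ≠ 0) {e : ℕ} (he : 1 ≤ e) {A B : ValuationSubring K}
    (hA : CC π e A) (hB : CC π e B) (hind : (prodRing A B : Set K) = Set.univ)
    {y z : K} (hz : z ≠ 0) (hzA : A.valuation z ≤ 1) (hy : y ∉ B) :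
    ∃ c : K, A.valuation (π / (π + c ^ (e + 1)) - 1) < A.valuation z ∧
      y * (π / (π + c ^ (e + 1))) ∈ B := by
  have : y / (π * z) ∈ (prodRing A B : Set K) := by rw [hind]; trivial
  obtain ⟨a, ha, b, hb, hab⟩ := this
  have hy0 : y ≠ 0 := by rintro rfl; exact hy B.zero_mem
  have hb0 : b ≠ 0 := by
    rintro rfl
    have : y / (π * z) ≠ 0 := div_ne_zero hy0 (mul_ne_zero hπ hz)
    simp [hab] at this
  have hcc : π * z * a = y / b := by
    field_simp at hab ⊢
    rw [hab]
  have hz' : 0 < A.valuation z := zero_lt_iff.2 (by simpa using hz)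
  have hp' : 0 < A.valuation π := zero_lt_iff.2 (by simpa using hπ)
  refine ⟨π * z * a, ?_, ?_⟩
  · have hc : A.valuation (π * z * a) ≤ A.valuation π * A.valuation z := by
      rw [map_mul, map_mul]
      exact mul_le_of_le_one_right' ((A.valuation_le_one_iff a).2 ha)
    set c := π * z * a
    have hc1 : A.valuation c < 1 :=
      hc.trans_lt ((mul_le_of_le_one_right' hzA).trans_lt hA.1)
    have hd := hA.small hπ hc1
    have hd0 : π + c ^ (e + 1) ≠ 0 := by
      intro h
      rw [h, map_zero] at hd
      exact hp'.ne hd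
    have : π / (π + c ^ (e + 1)) - 1 = - (c ^ (e + 1) / (π + c ^ (e + 1))) := by
      field_simp
      ring
    rw [this, Valuation.map_neg, map_div₀, hd, div_lt_iff₀ hp', map_pow, pow_succ', mul_comm (A.valuation z)]
    have hce : A.valuation c ^ e < 1 := pow_lt_one₀ zero_le' hc1 (by omega)
    calc A.valuation c * A.valuation c ^ e ≤ A.valuation π * A.valuation z * A.valuation c ^ e :=
          mul_le_mul_left hc _
      _ < A.valuation π * A.valuation z * 1 := mul_lt_mul_of_pos_left hce (mul_pos hp' hz')
      _ = _ := mul_one _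
  · rw [hcc]
    have hyB : 1 < B.valuation y := by
      rw [← B.valuation_le_one_iff] at hy
      exact not_le.1 hy
    have hyc : B.valuation y ≤ B.valuation (y / b) := by
      rw [map_div₀, le_div_iff₀ (zero_lt_iff.2 (by simpa using hb0))]
      exact mul_le_of_le_one_right' ((B.valuation_le_one_iff b).2 hb)
    set c := y / b
    have hc1 : 1 ≤ B.valuation c := hyB.le.trans hyc
    rw [← B.valuation_le_one_iff, map_mul, map_div₀, hB.large hc1, ← mul_div_assoc]
    refine div_le_one_of_le₀ ?_ zero_le'
    calc B.valuation y * B.valuation π ≤ B.valuation y := mul_le_of_le_one_right' hB.1.le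
      _ ≤ B.valuation c := hyc
      _ ≤ _ := le_self_pow₀ hc1 (by omega)

/-- ultrafilter limit of valuation rings -/
def ultraLim {ι : Type*} (F : Ultrafilter ι) (u : ι → ValuationSubring K) :
    ValuationSubring K where
  carrier := {x | ∀ᶠ i in (F : Filter ι), x ∈ u i}
  mul_mem' := by
    intro a b ha hb
    filter_upwards [ha, hb] with i h1 h2 using (u i).mul_mem _ _ h1 h2
  one_mem' := Filter.Eventually.of_forall fun i => (u i).one_mem
  zero_mem' := Filter.Eventually.of_forall fun i => (u i).zero_mem
  neg_mem' := by
    intro a ha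
    filter_upwards [ha] with i h1 using (u i).neg_mem _ h1
  add_mem' := by
    intro a b ha hb
    filter_upwards [ha, hb] with i h1 h2 using (u i).add_mem _ _ h1 h2
  mem_or_inv_mem' := by
    intro x
    exact Ultrafilter.eventually_or.1
      (Filter.Eventually.of_forall fun i => (u i).mem_or_inv_mem x)

lemma CC_iff {π : K} (hπ : π ≠ 0) (e : ℕ) (A : ValuationSubring K) :
    CC π e A ↔ π⁻¹ ∉ A ∧ ∀ x, x ∉ A → π * x ^ (e + 1) ∉ A := by
  have hp' : 0 < A.valuation π := zero_lt_iff.2 (by simpa using hπ)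
  simp only [CC, ← A.valuation_le_one_iff, not_le, map_inv₀, map_mul, map_pow, one_lt_inv₀ hp']

lemma CC_ultraLim {π : K} (hπ : π ≠ 0) (e : ℕ) {ι : Type*} (F : Ultrafilter ι)
    (u : ι → ValuationSubring K) (h : ∀ i, CC π e (u i)) : CC π e (ultraLim F u) := by
  simp only [CC_iff hπ] at h ⊢
  refine ⟨?_, fun x hx => ?_⟩
  · change ¬ ∀ᶠ i in (F : Filter ι), _
    rw [← Ultrafilter.eventually_not]
    exact Filter.Eventually.of_forall fun i => (h i).1
  · change ¬ ∀ᶠ i in (F : Filter ι), _ at hx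
    change ¬ ∀ᶠ i in (F : Filter ι), _
    rw [← Ultrafilter.eventually_not] at hx ⊢
    filter_upwards [hx] with i hi using (h i).2 x hi

lemma forward {π : K} (hπ : π ≠ 0) {e : ℕ} {A B : ValuationSubring K}
    (hA : CC π e A) (hB : CC π e B) (hAB : A ≠ B) : ∃ y ∈ A, y ∉ B := by
  by_contra hcon
  push Not at hcon
  apply hAB
  refine le_antisymm hcon fun x hx => ?_
  by_contra hxA
  rw [CC_iff hπ] at hA hB
  have h1 := hA.2 x hxA
  have h2 := hcon _ ((A.mem_or_inv_mem _).resolve_left h1)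
  have hx0 : x ≠ 0 := by rintro rfl; exact hxA A.zero_mem
  apply hB.1
  have h3 := B.mul_mem _ _ h2 (pow_mem hx (e + 1))
  convert h3 using 1
  field_simp

lemma backward {π : K} (hπ : π ≠ 0) {e : ℕ} (he : 1 ≤ e) {A : ValuationSubring K}
    (hA : CC π e A)
    (hind : ∀ B, CC π e B → A ≠ B → (prodRing A B : Set K) = Set.univ)
    {y z : K} (hy : y ∈ A) (hz : z ≠ 0) (hzA : A.valuation z ≤ 1) :
    ∃ x, (∀ B, CC π e B → x ∈ B) ∧ A.valuation (x - y) < A.valuation z := by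
  have hz' : 0 < A.valuation z := zero_lt_iff.2 (by simpa using hz)
  let E : Type _ := {t : K // (∀ B, CC π e B → t ∈ B) ∧ A.valuation (t - 1) < A.valuation z}
  have hmul : ∀ s t : E, ∃ r : E, r.1 = s.1 * t.1 := by
    rintro ⟨s, hs, hs'⟩ ⟨t, ht, ht'⟩
    refine ⟨⟨s * t, fun B hB => B.mul_mem _ _ (hs B hB) (ht B hB), ?_⟩, rfl⟩
    have : s * t - 1 = s * (t - 1) + (s - 1) := by ring
    rw [this]
    refine Valuation.map_add_lt _ ?_ hs'
    rw [map_mul]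
    exact (mul_le_of_le_one_left' ((A.valuation_le_one_iff s).2 (hs A hA))).trans_lt ht'
  have one : E := ⟨1, fun B _ => B.one_mem, by simpa using hz'⟩
  by_cases hgood : ∃ t : E, ∀ B, CC π e B → y * t.1 ∈ B
  · obtain ⟨t, ht⟩ := hgood
    refine ⟨y * t.1, ht, ?_⟩
    have : y * t.1 - y = y * (t.1 - 1) := by ring
    rw [this, map_mul]
    exact (mul_le_of_le_one_left' ((A.valuation_le_one_iff y).2 hy)).trans_lt t.2.2
  exfalso
  push Not at hgood
  choose u hu hyu using hgood
  let G : E → Set E := fun t => {r | ∃ s : E, r.1 = t.1 * s.1}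
  have hne : (⨅ t : E, Filter.principal (G t)).NeBot := by
    haveI : Nonempty E := ⟨one⟩
    refine Filter.iInf_neBot_of_directed' ?_ ?_
    · intro s t
      obtain ⟨r, hr⟩ := hmul s t
      refine ⟨r, ?_, ?_⟩
      · refine Filter.principal_mono.2 ?_
        rintro q ⟨q', hq⟩
        obtain ⟨w, hw⟩ := hmul t q'
        exact ⟨w, by rw [hq, hr, hw, mul_assoc]⟩
      · refine Filter.principal_mono.2 ?_
        rintro q ⟨q', hq⟩
        obtain ⟨w, hw⟩ := hmul s q'
        exact ⟨w, by rw [hq, hr, hw]; ring⟩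
    · intro t
      rw [Filter.principal_neBot_iff]
      obtain ⟨r, hr⟩ := hmul t t
      exact ⟨r, t, hr⟩
  let F : Ultrafilter E := @Ultrafilter.of _ _ hne
  have hF : ∀ t, ∀ᶠ r in (F : Filter E), r ∈ G t := by
    intro t
    have h1 : (F : Filter E) ≤ ⨅ t : E, Filter.principal (G t) := @Ultrafilter.of_le _ _ hne
    exact h1 (Filter.mem_iInf_of_mem t (Filter.mem_principal_self _))
  have hC := CC_ultraLim hπ e F u hu
  have hnot : ∀ t : E, y * t.1 ∉ ultraLim F u := by
    intro t hmem
    change ∀ᶠ i in (F : Filter E), y * t.1 ∈ u i at hmem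
    obtain ⟨r, h1, s, hs⟩ := (hmem.and (hF t)).exists
    apply hyu r
    rw [hs, ← mul_assoc]
    exact (u r).mul_mem _ _ h1 (s.2.1 _ (hu r))
  have hyL : y ∉ ultraLim F u := by
    have := hnot ⟨1, fun B _ => B.one_mem, by simpa using hz'⟩
    simpa using this
  have hneq : A ≠ ultraLim F u := by
    intro h
    rw [← h] at hyL
    exact hyL hy
  obtain ⟨c, hc1, hc2⟩ := separate hπ he hA hC (hind _ hC hneq) hz hzA hyL
  exact hnot ⟨_, fun B hB => hB.integral hπ c, hc1⟩ hc2

/-- **Proposition 5.7**: the holomorphy ring `R_π^e(K) = ⋂_{v ∈ S_π^e(K)} O_v` is dense in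
each `O_v` (`v ∈ S_π^e(K)`) iff the elements of `S_π^e(K)` are pairwise independent. -/
theorem holomorphy_ring_dense_iff {K : Type*} [Field K] (π : K) (hπ : π ≠ 0)
    (e : ℕ) (he : 1 ≤ e) :
    (∀ v ∈ SPiE π e, ∀ y ∈ v, ∀ z : K, z ≠ 0 →
        ∃ x ∈ ⋂₀ SPiE π e, x - y ∈ scale z (mball v)) ↔
      ∀ v₁ ∈ SPiE π e, ∀ v₂ ∈ SPiE π e, v₁ ≠ v₂ →
        ∀ W : Set K, IsValuationLocality W → v₁ ⊆ W → v₂ ⊆ W → W = Set.univ := by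
  constructor
  · intro H v₁ hv₁ v₂ hv₂ hne W hW h1W h2W
    obtain ⟨A, rfl, -⟩ := id hv₁
    obtain ⟨B, rfl, -⟩ := id hv₂
    obtain ⟨W, rfl⟩ := hW
    have hA := (mem_SPiE_iff hπ e A).1 hv₁
    have hB := (mem_SPiE_iff hπ e B).1 hv₂
    obtain ⟨y, hyA, hyB⟩ := forward hπ hA hB (fun h => hne (by rw [h]))
    by_contra hWne
    obtain ⟨s, hs⟩ := (Set.ne_univ_iff_exists_notMem _).1 hWne
    have hs0 : s ≠ 0 := by rintro rfl; exact hs W.zero_mem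
    obtain ⟨x, hx, m, hm, hxm⟩ := H _ hv₁ y hyA s⁻¹ (inv_ne_zero hs0)
    have hxB : x ∈ B := hx _ hv₂
    have hmW : m ∈ W := h1W hm.1
    apply hyB
    have hyx : y = x - (x - y) := by ring
    rw [hyx]
    refine sub_mem hxB ?_
    by_contra hnB
    have h3 : (x - y)⁻¹ ∈ W := h2W ((B.mem_or_inv_mem _).resolve_left hnB)
    have hxy0 : x - y ≠ 0 := by
      intro h
      rw [h] at hnB
      exact hnB B.zero_mem
    apply hs
    have h4 : s = (x - y)⁻¹ * m := by
      rw [eq_inv_mul_iff_mul_eq₀ hxy0, hxm]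
      field_simp
    rw [h4]
    exact W.mul_mem _ _ h3 hmW
  · intro H v hv y hy z hz
    obtain ⟨A, rfl, -⟩ := id hv
    have hA := (mem_SPiE_iff hπ e A).1 hv
    have hind : ∀ B, CC π e B → A ≠ B → (prodRing A B : Set K) = Set.univ := by
      intro B hB hAB
      refine H _ hv _ ((mem_SPiE_iff hπ e B).2 hB) (fun h => hAB (SetLike.coe_injective h)) _
        ⟨_, rfl⟩ ?_ ?_
      · intro a ha
        exact ⟨a, ha, 1, B.one_mem, by ring⟩
      · intro b hb
        exact ⟨1, A.one_mem, b, hb, by ring⟩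
    have hz1 : ∃ z' : K, z' ≠ 0 ∧ A.valuation z' ≤ 1 ∧ A.valuation z' ≤ A.valuation z := by
      rcases le_total (A.valuation z) 1 with h | h
      · exact ⟨z, hz, h, le_rfl⟩
      · exact ⟨1, one_ne_zero, by simp, by simpa using h⟩
    obtain ⟨z', hz', h1, h2⟩ := hz1
    obtain ⟨x, hx, hxy⟩ := backward hπ he hA hind hy hz' h1
    refine ⟨x, ?_, (mem_scale_iff A hz _).2 (hxy.trans_le h2)⟩
    intro v' hv'
    obtain ⟨B, rfl, -⟩ := id hv'
    exact hx B ((mem_SPiE_iff hπ e B).1 hv')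

end PaperApprox
end

section
/- Approximation with exceptional localities, strict version: Let K be a field, S_1, …, S_n sets of localities on K, t ∈ K^×, x_1, …, x_n ∈ K and z_1, …, z_n ∈ K^×. Assume: (U) Assumption (U-exc) holds for S_1, …, S_n and t; (T) each S_i is compact in the topology T_{Zar*}; (I) for any valuation ring O_w of K having a refinement in S_i and a refinement in S_j we have x_i − x_j ∈ z_i·O_w and z_i·O_w = z_j·O_w, and moreover the sets S_1, …, S_n are pairwise t-independent and pairwise incomparable. Then there exists x ∈ K with x − x_i ∈ z_i·m_v for all v ∈ S_i, for i = 1, …, n. -/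
namespace PaperApprox
section
universe u

lemma ordering_loc {K : Type u} [Field K] {O : Set K} (h : IsOrderingLocality O) :
    ∃ (_ : LinearOrder K) (_ : IsStrictOrderedRing K), ∀ x, x ∈ O ↔ |x| ≤ 1 := by
  classical
  obtain ⟨P, ⟨hadd, hmul, htot, hanti⟩, rfl⟩ := h
  have h0 : (0 : K) ∈ P := by rcases htot 0 with h | h <;> simpa using h
  have h1 : (1 : K) ∈ P := by
    rcases htot 1 with h | h
    · exact h
    · simpa using hmul _ h _ h
  let lo : LinearOrder K :=
    { le := fun a b => b - a ∈ P
      le_refl := fun a => by simpa using h0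
      le_trans := fun a b c hab hbc => by
        have := hadd _ hab _ hbc
        simpa using this
      le_antisymm := fun a b hab hba => by
        have := hanti _ hab (by simpa using hba)
        exact (sub_eq_zero.1 this).symm
      le_total := fun a b => by
        rcases htot (b - a) with h | h
        · exact Or.inl h
        · right; simpa using h
      toDecidableLE := Classical.decRel _ }
  have hle : ∀ a b : K, a ≤ b ↔ b - a ∈ P := fun a b => Iff.rfl
  have : IsOrderedAddMonoid K :=
    { add_le_add_left := fun a b hab c => by
        rw [hle] at *; simpa using hab }
  have : ZeroLEOneClass K := ⟨by rw [hle]; simpa using h1⟩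
  have : IsOrderedRing K := IsOrderedRing.of_mul_nonneg (fun a b ha hb => by
    rw [hle] at *; simp only [sub_zero] at *; exact hmul _ ha _ hb)
  have : IsStrictOrderedRing K := IsOrderedRing.toIsStrictOrderedRing K
  refine ⟨lo, this, fun x => ?_⟩
  rw [abs_le, hle, hle]
  simp [orderingBall]

/-- A generalized norm. -/
structure Nrm (K : Type u) [Field K] where
  Γ : Type u
  inst : LinearOrderedCommGroupWithZero Γ
  N : K →*₀ Γ

attribute [instance] Nrm.inst

noncomputable def ulNN : LinearOrderedCommGroupWithZero (ULift.{u} NNReal) :=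
  { (inferInstance : CommGroupWithZero (ULift.{u} NNReal)),
    (inferInstance : LinearOrder (ULift.{u} NNReal)) with
    bot := ⟨0⟩
    bot_le := fun a => by change (0 : NNReal) ≤ a.down; exact bot_le
    isBot_zero := fun a => by change (0 : NNReal) ≤ a.down; exact bot_le
    mul_lt_mul_of_pos_left := fun a ha b c hbc => by
      change a.down * b.down < a.down * c.down
      have h : b.down < c.down := hbc
      have h' : 0 < a.down := ha
      gcongr }

lemma exists_nrm {K : Type u} [Field K] {O : Set K} (h : IsLocality O) :
    ∃ B : Nrm K, ∀ x, x ∈ O ↔ B.N x ≤ 1 := by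
  rcases h with ⟨A, rfl⟩ | h | ⟨f, rfl⟩
  · exact ⟨⟨A.ValueGroup, inferInstance, A.valuation.toMonoidWithZeroHom⟩,
      fun x => (A.valuation_le_one_iff x).symm⟩
  · obtain ⟨lo, hs, hO⟩ := ordering_loc h
    refine ⟨⟨{x : K // 0 ≤ x}, inferInstance,
      { toFun := fun x => ⟨|x|, abs_nonneg x⟩
        map_zero' := by ext; simp
        map_one' := by ext; simp
        map_mul' := fun a b => by ext; simp [abs_mul] }⟩, fun x => ?_⟩
    rw [hO]; rfl
  · let i : LinearOrderedCommGroupWithZero (ULift.{u} NNReal) := ulNN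
    refine ⟨⟨ULift.{u} NNReal, ulNN,
      { toFun := fun x => ⟨⟨f x, f.nonneg x⟩⟩
        map_zero' := by ext; simp; rfl
        map_one' := by ext; simp; rfl
        map_mul' := fun a b => by ext; simp; rfl }⟩, fun x => ?_⟩
    rfl

end
end PaperApprox

namespace PaperApprox
section
universe u
variable {K : Type u} [Field K]

lemma Nrm.N_neg (B : Nrm K) (x : K) : B.N (-x) = B.N x := by
  have h1 : B.N (-1) = 1 := by
    have h : B.N (-1) ^ 2 = 1 := by rw [← map_pow]; simp
    exact (pow_eq_one_iff.1 h).resolve_right (by norm_num)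
  rw [← neg_one_mul, map_mul, h1, one_mul]

lemma loc_one {O : Set K} (h : IsLocality O) : (1 : K) ∈ O := by
  obtain ⟨B, hB⟩ := exists_nrm h; rw [hB]; simp
lemma loc_zero {O : Set K} (h : IsLocality O) : (0 : K) ∈ O := by
  obtain ⟨B, hB⟩ := exists_nrm h; rw [hB]; simp
lemma loc_mul {O : Set K} (h : IsLocality O) {a b : K} (ha : a ∈ O) (hb : b ∈ O) : a * b ∈ O := by
  obtain ⟨B, hB⟩ := exists_nrm h; rw [hB] at *; rw [map_mul]; exact mul_le_one' ha hb
lemma loc_neg {O : Set K} (h : IsLocality O) {a : K} (ha : a ∈ O) : -a ∈ O := by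
  obtain ⟨B, hB⟩ := exists_nrm h; rw [hB] at *; rwa [B.N_neg]
lemma loc_inv {O : Set K} (h : IsLocality O) {a : K} (ha : a ∉ O) : a⁻¹ ∈ O := by
  obtain ⟨B, hB⟩ := exists_nrm h; rw [hB] at *; rw [map_inv₀]
  exact inv_le_one_of_one_le₀ (not_le.1 ha).le
lemma loc_pow {O : Set K} (h : IsLocality O) {a : K} (ha : a ∈ O) (k : ℕ) : a ^ k ∈ O := by
  induction k with
  | zero => simpa using loc_one h
  | succ k ih => rw [pow_succ]; exact loc_mul h ih ha

lemma pow_bdd_le_one {a C : ℝ} (h : ∀ k : ℕ, a ^ k ≤ C) : a ≤ 1 := by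
  by_contra hc
  obtain ⟨k, hk⟩ := pow_unbounded_of_one_lt C (not_le.1 hc)
  exact absurd (h k) (not_le.2 hk)

lemma abs_nonarch_val (f : AbsoluteValue K ℝ) (h : ∀ n : ℕ, f n ≤ 1) :
    IsValuationLocality {x | f x ≤ 1} := by
  have hadd : ∀ x y, f x ≤ 1 → f y ≤ 1 → f (x + y) ≤ 1 := by
    intro x y hx hy
    have key : ∀ m : ℕ, f (x + y) ^ m ≤ m + 1 := by
      intro m
      rw [← map_pow, add_pow]
      refine (f.sum_le _ _).trans ?_
      have : ∀ i ∈ Finset.range (m + 1), f (x ^ i * y ^ (m - i) * (m.choose i : K)) ≤ 1 := by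
        intro i _
        rw [map_mul, map_mul, map_pow, map_pow]
        refine mul_le_one₀ (mul_le_one₀ (pow_le_one₀ (f.nonneg _) hx) (by positivity)
          (pow_le_one₀ (f.nonneg _) hy)) (f.nonneg _) (h _)
      refine (Finset.sum_le_sum this).trans ?_
      simp
    by_contra hc
    push Not at hc
    set a := f (x + y)
    have hd : 0 < a - 1 := by linarith
    obtain ⟨m, hm⟩ := exists_nat_gt (2 / (a - 1) ^ 2)
    have hb : 1 + (m : ℝ) * (a - 1) ≤ a ^ m := by
      have := one_add_mul_le_pow (show (-2 : ℝ) ≤ a - 1 by linarith) m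
      simpa using this
    have h2 := key (2 * m)
    rw [two_mul, pow_add] at h2
    push_cast at h2
    rw [div_lt_iff₀ (by positivity)] at hm
    have hm0 : (0 : ℝ) ≤ m := by positivity
    have h3 : (1 + (m : ℝ) * (a - 1)) * (1 + (m : ℝ) * (a - 1)) ≤ a ^ m * a ^ m := by
      gcongr
    have h4 : 2 < m * (a-1)^2 := hm
    have hmp : (0 : ℝ) < m := by
      rcases hm0.lt_or_eq with h | h
      · exact h
      · rw [← h] at h4; norm_num at h4
    have : (m : ℝ) * 2 < m * (m * (a-1)^2) := by gcongr
    nlinarith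
  refine ⟨{ carrier := {x | f x ≤ 1}, mul_mem' := ?_, one_mem' := by simp, add_mem' := ?_,
            zero_mem' := by simp, neg_mem' := ?_, mem_or_inv_mem' := ?_ }, rfl⟩
  · intro a b ha hb
    simp only [Set.mem_ofPred_eq, map_mul] at *
    exact mul_le_one₀ ha (f.nonneg _) hb
  · intro a b ha hb; exact hadd a b ha hb
  · intro a ha; simpa using ha
  · intro a
    simp only [Set.mem_ofPred_eq, map_inv₀]
    rcases le_total (f a) 1 with h | h
    · exact Or.inl h
    · exact Or.inr (inv_le_one_of_one_le₀ h)

lemma loc_cases {O : Set K} (h : IsLocality O) : IsValuationLocality O ∨ IsOrderingLocality O ∨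
    ∃ f : AbsoluteValue K ℝ, (∀ x, x ∈ O ↔ f x ≤ 1) ∧ ∃ n : ℕ, 1 < f n := by
  rcases h with h | h | ⟨f, rfl⟩
  · exact Or.inl h
  · exact Or.inr (Or.inl h)
  · by_cases hf : ∀ n : ℕ, f n ≤ 1
    · exact Or.inl (abs_nonarch_val f hf)
    · push Not at hf
      exact Or.inr (Or.inr ⟨f, fun _ => Iff.rfl, hf⟩)

lemma nat_mem_val {O : Set K} (h : IsValuationLocality O) (n : ℕ) : (n : K) ∈ O := by
  obtain ⟨A, rfl⟩ := h; exact natCast_mem A n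

lemma coarse_eq {v W : Set K} (hv : IsLocality v) (hW : IsLocality W) (hvW : v ⊆ W)
    (hnv : ¬ IsValuationLocality W) : W ⊆ v := by
  intro x hx
  by_contra hxv
  have hxi : x⁻¹ ∈ v := loc_inv hv hxv
  have hx0 : x ≠ 0 := fun h => hxv (h ▸ loc_zero hv)
  rcases loc_cases hW with h | h | ⟨f, hf, n, hn⟩
  · exact hnv h
  · obtain ⟨_, _, hO⟩ := ordering_loc h
    have h1 := (hO _).1 hx
    have h2 := (hO _).1 (hvW hxi)
    rw [abs_inv] at h2
    have h3 : 1 ≤ |x| := by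
      by_contra hc
      have : 1 < |x|⁻¹ := (one_lt_inv₀ (abs_pos.2 hx0)).2 (not_le.1 hc)
      exact absurd h2 (not_le.2 this)
    have h4 : |x| = 1 := le_antisymm h1 h3
    rcases eq_or_eq_neg_of_abs_eq h4 with h | h
    · exact hxv (h ▸ loc_one hv)
    · exact hxv (h ▸ loc_neg hv (loc_one hv))
  · -- f x = 1
    have hfx : f x ≤ 1 := (hf _).1 hx
    have hn0 : (n : K) ≠ 0 := by
      intro h; rw [h] at hn; simp at hn; linarith
    -- elements with f < 1 lie in v, and inverses are not in v
    have hsmall : ∀ y, f y < 1 → y ∈ v := by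
      intro y hy
      by_contra hyv
      have h1 := (hf _).1 (hvW (loc_inv hv hyv))
      have hy0 : y ≠ 0 := fun h => hyv (h ▸ loc_zero hv)
      rw [map_inv₀] at h1
      have : 1 < (f y)⁻¹ := (one_lt_inv₀ (f.pos hy0)).2 hy
      linarith
    have hpow : ∀ k : ℕ, x ^ k * (n : K)⁻¹ ∈ v := by
      intro k
      apply hsmall
      rw [map_mul, map_pow, map_inv₀]
      have h1 : f x ^ k ≤ 1 := pow_le_one₀ (f.nonneg _) hfx
      have h2 : (f n)⁻¹ < 1 := inv_lt_one_of_one_lt₀ hn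
      have h3 : 0 ≤ (f n)⁻¹ := by positivity
      nlinarith
    rcases loc_cases hv with h | h | ⟨g, hg, m, hm⟩
    · have := (hf _).1 (hvW (nat_mem_val h n))
      linarith
    · obtain ⟨_, _, hO⟩ := ordering_loc h
      have hx1 : 1 < |x| := not_le.1 (fun hc => hxv ((hO _).2 hc))
      have hnpos : (0 : K) < n := lt_of_le_of_ne (by positivity) (Ne.symm hn0)
      -- δ
      have hδ : ∀ k : ℕ, (k : K) * (|x| - 1) ≤ n := by
        intro k
        have h1 := (hO _).1 (hpow k)
        rw [abs_mul, abs_pow, abs_inv, abs_of_pos hnpos, mul_inv_le_iff₀ hnpos, one_mul] at h1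
        have h2 : 1 + (k : K) * (|x| - 1) ≤ (1 + (|x| - 1)) ^ k :=
          one_add_mul_le_pow (by linarith) k
        rw [add_sub_cancel] at h2
        linarith
      have hd0 : |x| - 1 ≠ 0 := by linarith
      have hmem : ∀ k : ℕ, (k : K) * (|x| - 1) * (n : K)⁻¹ ∈ v := by
        intro k
        rw [hO, abs_of_nonneg]
        · rw [mul_inv_le_iff₀ hnpos, one_mul]; exact hδ k
        · have : 0 ≤ |x| - 1 := by linarith
          positivity
      have hb : ∀ k : ℕ, f n ^ k ≤ f n * (f (|x| - 1))⁻¹ := by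
        intro k
        have h1 := (hf _).1 (hvW (hmem (n ^ k)))
        have hp : 0 < f (|x| - 1) := f.pos hd0
        have hp' : 0 < f n := by linarith
        push_cast at h1
        rw [map_mul, map_mul, map_pow, map_inv₀, mul_inv_le_iff₀ hp', one_mul] at h1
        rw [← div_eq_mul_inv, le_div_iff₀ hp]
        exact h1
      have := pow_bdd_le_one hb
      linarith
    · apply hxv
      rw [hg]
      apply pow_bdd_le_one (C := g n)
      intro k
      have h1 := (hg _).1 (hpow k)
      have hp : 0 < g n := g.pos hn0
      rwa [map_mul, map_pow, map_inv₀, mul_inv_le_iff₀ hp, one_mul] at h1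

end
end PaperApprox

namespace PaperApprox
section
universe u
variable {K : Type u} [Field K]

/-- product set -/
def prodSet (v w : Set K) : Set K := {c | ∃ a ∈ v, ∃ b ∈ w, c = a * b}

lemma prodSet_comm (v w : Set K) : prodSet v w = prodSet w v := by
  ext c
  constructor <;> rintro ⟨a, ha, b, hb, rfl⟩ <;> exact ⟨b, hb, a, ha, mul_comm _ _⟩

lemma left_sub_prod {v w : Set K} (hw : IsLocality w) : v ⊆ prodSet v w :=
  fun a ha => ⟨a, ha, 1, loc_one hw, by simp⟩

lemma right_sub_prod {v w : Set K} (hv : IsLocality v) : w ⊆ prodSet v w :=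
  fun a ha => ⟨1, loc_one hv, a, ha, by simp⟩

lemma prod_mul {v w : Set K} (hv : IsLocality v) (hw : IsLocality w) {c d : K}
    (hc : c ∈ prodSet v w) (hd : d ∈ prodSet v w) : c * d ∈ prodSet v w := by
  obtain ⟨a, ha, b, hb, rfl⟩ := hc
  obtain ⟨a', ha', b', hb', rfl⟩ := hd
  exact ⟨a * a', loc_mul hv ha ha', b * b', loc_mul hw hb hb', by ring⟩

lemma prod_neg {v w : Set K} (hv : IsLocality v) {c : K}
    (hc : c ∈ prodSet v w) : -c ∈ prodSet v w := by
  obtain ⟨a, ha, b, hb, rfl⟩ := hc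
  exact ⟨-a, loc_neg hv ha, b, hb, by ring⟩

/-- sums of products -/
lemma prod_add_aux {v w : Set K} (hv : IsLocality v) (hw : IsLocality w) {c d : K}
    (hc : c ∈ prodSet v w) (hd : d ∈ prodSet v w) :
    ∃ s ∈ v, ∃ s' ∈ v, ∃ b ∈ w, c + d = (s + s') * b := by
  -- reduce to the case b' = b * γ
  have key : ∀ a ∈ v, ∀ a' ∈ v, ∀ b ∈ w, ∀ g ∈ w,
      ∃ s ∈ v, ∃ s' ∈ v, ∃ b' ∈ w, a * b + a' * (b * g) = (s + s') * b' := by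
    intro a ha a' ha' b hb g hg
    by_cases hgv : g ∈ v
    · exact ⟨a, ha, a' * g, loc_mul hv ha' hgv, b, hb, by ring⟩
    · have hg0 : g ≠ 0 := fun h => hgv (h ▸ loc_zero hv)
      exact ⟨a * g⁻¹, loc_mul hv ha (loc_inv hv hgv), a', ha', b * g, loc_mul hw hb hg,
        by field_simp⟩
  obtain ⟨a, ha, b, hb, rfl⟩ := hc
  obtain ⟨a', ha', b', hb', rfl⟩ := hd
  by_cases hb0 : b = 0
  · exact ⟨a', ha', 0, loc_zero hv, b', hb', by rw [hb0]; ring⟩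
  by_cases hb0' : b' = 0
  · exact ⟨a, ha, 0, loc_zero hv, b, hb, by rw [hb0']; ring⟩
  by_cases hg : b' * b⁻¹ ∈ w
  · obtain ⟨s, hs, s', hs', c, hc, h⟩ := key a ha a' ha' b hb _ hg
    refine ⟨s, hs, s', hs', c, hc, ?_⟩
    rw [← h]; field_simp
  · have hg' := loc_inv hw hg
    obtain ⟨s, hs, s', hs', c, hc, h⟩ := key a' ha' a ha b' hb' _ hg'
    refine ⟨s, hs, s', hs', c, hc, ?_⟩
    rw [← h]; field_simp; ring

lemma prod_add_val {v w : Set K} (hv : IsLocality v) (hw : IsLocality w)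
    (hval : IsValuationLocality v) {c d : K}
    (hc : c ∈ prodSet v w) (hd : d ∈ prodSet v w) : c + d ∈ prodSet v w := by
  obtain ⟨s, hs, s', hs', b, hb, h⟩ := prod_add_aux hv hw hc hd
  refine ⟨s + s', ?_, b, hb, h⟩
  obtain ⟨A, rfl⟩ := hval
  exact add_mem (S := ValuationSubring K) hs hs'

lemma prod_add_abs {v w : Set K} (hv : IsLocality v) (hw : IsLocality w)
    (hinc : Incomp v w)
    (f : AbsoluteValue K ℝ) (hf : ∀ x, x ∈ v ↔ f x ≤ 1) (n : ℕ) (hn : 1 < f n) {c d : K}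
    (hc : c ∈ prodSet v w) (hd : d ∈ prodSet v w) : c + d ∈ prodSet v w := by
  obtain ⟨s, hs, s', hs', b, hb, h⟩ := prod_add_aux hv hw hc hd
  obtain ⟨k, hk⟩ := pow_unbounded_of_one_lt 2 hn
  have hp : 0 < f (n ^ k) := by rw [map_pow]; linarith
  have hn0 : (n : K) ^ k ≠ 0 := f.ne_zero_iff.1 hp.ne'
  have hmem : (n : K) ^ k ∈ prodSet v w := by
    by_contra hcon
    apply hinc.2
    intro a ha
    rw [hf]
    apply pow_bdd_le_one (C := f (n ^ k))
    intro j
    by_contra hlt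
    push Not at hlt
    apply hcon
    have ha0 : a ^ j ≠ 0 := by
      rw [← map_pow] at hlt
      exact f.ne_zero_iff.1 (hp.trans hlt).ne'
    refine ⟨n ^ k * (a ^ j)⁻¹, ?_, a ^ j, loc_pow hw ha j, by field_simp⟩
    rw [hf, map_mul, map_inv₀, map_pow f a j, mul_inv_le_iff₀ (hp.trans hlt), one_mul]
    exact hlt.le
  have : c + d = (n : K) ^ k * (((s + s') * ((n : K) ^ k)⁻¹) * b) := by rw [h]; field_simp
  rw [this]
  refine prod_mul hv hw hmem ⟨_, ?_, b, hb, rfl⟩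
  rw [hf, map_mul, map_inv₀, mul_inv_le_iff₀ hp, one_mul]
  have h1 := f.add_le s s'
  have h2 := (hf _).1 hs
  have h3 := (hf _).1 hs'
  rw [map_pow]
  linarith

lemma fcc_of_val {v w : Set K} (hv : IsLocality v) (hw : IsLocality w) (hinc : Incomp v w)
    (A : ValuationSubring K) (h1 : v ⊆ A) (h2 : w ⊆ A)
    (h3 : ∀ B : ValuationSubring K, v ⊆ B → w ⊆ B → A ≤ B) : IsFCC v w A := by
  refine ⟨Or.inl ⟨A, rfl⟩, h1, h2, ?_⟩
  intro W hW hvW hwW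
  by_cases hval : IsValuationLocality W
  · obtain ⟨B, rfl⟩ := hval
    exact h3 B hvW hwW
  · exact absurd (hwW.trans (coarse_eq hv hW hvW hval)) hinc.2

lemma half_residue {v w : Set K} (hv : IsLocality v) (hw : IsLocality w)
    (hwo : IsOrderingLocality w) (h2 : (2 : K) ∉ prodSet v w) (A : ValuationSubring K)
    (hvA : v ⊆ A) (hwA : w ⊆ A)
    (hA : ∀ x ∈ A, ∃ k : ℕ, x * (2 ^ k)⁻¹ ∈ prodSet v w) (x : K) (hx : x ∈ v) :
    ∃ y ∈ w, x - y ∈ mball (A : Set K) := by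
  obtain ⟨_, _, hO⟩ := ordering_loc hwo
  have hv2 : ∀ a ∈ v, |a| < 2 := by
    intro a ha
    by_contra hc
    push Not at hc
    have ha0 : a ≠ 0 := by
      rintro rfl
      rw [abs_zero] at hc
      linarith
    have hap : 0 < |a| := abs_pos.2 ha0
    apply h2
    refine ⟨a, ha, 2 * a⁻¹, ?_, by field_simp⟩
    rw [hO, abs_mul, abs_inv, mul_inv_le_iff₀ hap, one_mul]
    simpa using hc
  have hprod : ∀ c ∈ prodSet v w, |c| < 2 := by
    rintro c ⟨a, ha, b, hb, rfl⟩
    have h1 := hv2 a ha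
    have h3 := (hO _).1 hb
    rw [abs_mul]
    nlinarith [abs_nonneg a, abs_nonneg b]
  by_cases hxw : x ∈ w
  · refine ⟨x, hxw, ?_⟩
    simp [mball]
  have hx1 : 1 < |x| := not_le.1 (fun hc => hxw ((hO _).2 hc))
  have hd : ∀ k : ℕ, (k : K) * (|x| - 1) < 1 := by
    intro k
    have h1 := hv2 _ (loc_pow hv hx k)
    rw [abs_pow] at h1
    have h2 : 1 + (k : K) * (|x| - 1) ≤ (1 + (|x| - 1)) ^ k :=
      one_add_mul_le_pow (by linarith) k
    rw [add_sub_cancel] at h2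
    linarith
  -- choose y
  obtain ⟨y, hy, hxy⟩ : ∃ y ∈ w, |x - y| = |x| - 1 := by
    rcases le_total 0 x with h | h
    · refine ⟨1, loc_one hw, ?_⟩
      rw [abs_of_nonneg h] at *
      rw [abs_of_nonneg (by linarith)]
    · refine ⟨-1, loc_neg hw (loc_one hw), ?_⟩
      rw [abs_of_nonpos h] at *
      rw [abs_of_nonpos (by linarith)]; ring
  refine ⟨y, hy, sub_mem (hvA hx) (hwA hy), ?_⟩
  rintro ⟨-, hne, hinv⟩
  obtain ⟨k, hk⟩ := hA _ hinv
  have h3 := hprod _ hk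
  have hp : 0 < |x| - 1 := by linarith
  have hp2 : (0 : K) < 2 ^ k := by positivity
  rw [abs_mul, abs_inv, abs_inv, hxy, abs_of_pos hp2, mul_inv_lt_iff₀ hp2, inv_lt_iff_one_lt_mul₀ hp] at h3
  have h4 := hd (2 * 2 ^ k)
  push_cast at h4
  linarith

lemma two_mem_prod {v w : Set K} (hv : IsLocality v) (hw : IsLocality w)
    (hvo : IsOrderingLocality v) (hwo : IsOrderingLocality w)
    (hs : StronglyIncomp v w) : (2 : K) ∈ prodSet v w := by
  by_contra h2
  have hord : ∀ {o : Set K}, IsOrderingLocality o → (∀ k : ℕ, ((2 : K) ^ k)⁻¹ ∈ o) ∧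
      (∀ a ∈ o, ∀ b ∈ o, (a + b) * 2⁻¹ ∈ o) ∧ ((2 : K) ≠ 0) := by
    intro o ho
    obtain ⟨_, _, hO⟩ := ordering_loc ho
    refine ⟨fun k => ?_, fun a ha b hb => ?_, two_ne_zero⟩
    · have hp2 : (0 : K) < 2 ^ k := by positivity
      rw [hO, abs_of_pos (by positivity)]
      exact inv_le_one_of_one_le₀ (one_le_pow₀ (by norm_num))
    · rw [hO] at *
      rw [abs_mul, abs_of_pos (show (0 : K) < 2⁻¹ by positivity)]
      have := abs_add_le a b
      linarith
  obtain ⟨hk, hadd, h20⟩ := hord hvo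
  let A : ValuationSubring K :=
    { carrier := {x | ∃ k : ℕ, x * (2 ^ k)⁻¹ ∈ prodSet v w}
      mul_mem' := by
        rintro a b ⟨k, hk⟩ ⟨l, hl⟩
        refine ⟨k + l, ?_⟩
        have := prod_mul hv hw hk hl
        rw [pow_add, mul_inv]
        convert this using 1; ring
      one_mem' := ⟨0, by simpa using left_sub_prod hw (loc_one hv)⟩
      zero_mem' := ⟨0, by simpa using left_sub_prod hw (loc_zero hv)⟩
      neg_mem' := by
        rintro a ⟨k, hk⟩
        exact ⟨k, by simpa using prod_neg hv hk⟩
      add_mem' := by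
        rintro a b ⟨k, hk'⟩ ⟨l, hl'⟩
        have h1 := prod_mul hv hw hk' (left_sub_prod hw (hk l))
        have h3 := prod_mul hv hw hl' (left_sub_prod hw (hk k))
        obtain ⟨s, hs, s', hs', c, hc, h⟩ := prod_add_aux hv hw h1 h3
        refine ⟨k + l + 1, (s + s') * 2⁻¹, hadd s hs s' hs', c, hc, ?_⟩
        rw [mul_right_comm, ← h]
        field_simp
        ring
      mem_or_inv_mem' := by
        intro x
        by_cases hx : x ∈ v
        · exact Or.inl ⟨0, by simpa using left_sub_prod hw hx⟩
        · exact Or.inr ⟨0, by simpa using left_sub_prod hw (loc_inv hv hx)⟩ }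
  have hmemA : ∀ x, x ∈ A ↔ ∃ k : ℕ, x * (2 ^ k)⁻¹ ∈ prodSet v w := fun x => Iff.rfl
  have hvA : v ⊆ A := fun x hx => (hmemA x).2 ⟨0, by simpa using left_sub_prod hw hx⟩
  have hwA : w ⊆ A := fun x hx => (hmemA x).2 ⟨0, by simpa using right_sub_prod hv hx⟩
  have hfcc : IsFCC v w A := by
    refine fcc_of_val hv hw hs.1 A hvA hwA ?_
    intro B hvB hwB x hx
    obtain ⟨k, a, ha, b, hb, h⟩ := (hmemA x).1 hx
    have h2B : (2 : K) ^ k ∈ B := pow_mem (by simp [ofNat_mem]) k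
    have : x = a * b * 2 ^ k := by rw [← h]; field_simp
    rw [this]
    exact mul_mem (mul_mem (hvB ha) (hwB hb)) h2B
  apply hs.2 _ hfcc
  refine ⟨half_residue hv hw hwo h2 A hvA hwA (fun x hx => hx), ?_⟩
  intro y hy
  obtain ⟨x, hx, hxy⟩ := half_residue hw hv hvo (by rwa [prodSet_comm]) A hwA hvA
    (fun x hx => by rw [prodSet_comm]; exact hx) y hy
  refine ⟨x, hx, ?_⟩
  rw [← neg_sub]
  obtain ⟨h1, h3⟩ := hxy
  refine ⟨neg_mem (S := ValuationSubring K) h1, fun h4 => h3 ⟨h1, ?_⟩⟩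
  obtain ⟨-, h5, h6⟩ := h4
  refine ⟨fun h => h5 (by rw [h, neg_zero]), ?_⟩
  rw [inv_neg] at h6
  have := neg_mem (S := ValuationSubring K) (s := A) h6
  simpa using this

/-- The product set is the finest common coarsening and a valuation ring. -/
lemma prod_fcc {v w : Set K} (hv : IsLocality v) (hw : IsLocality w) (hinc : Incomp v w)
    (hs : IsOrderingLocality v → IsOrderingLocality w → StronglyIncomp v w) :
    ∃ A : ValuationSubring K, (A : Set K) = prodSet v w ∧ IsFCC v w A := by
  have hadd : ∀ {c d : K}, c ∈ prodSet v w → d ∈ prodSet v w → c + d ∈ prodSet v w := by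
    intro c d hc hd
    rcases loc_cases hv with h | h | ⟨f, hf, n, hn⟩
    · exact prod_add_val hv hw h hc hd
    · rcases loc_cases hw with h' | h' | ⟨f, hf, n, hn⟩
      · rw [prodSet_comm] at *
        exact prod_add_val hw hv h' hc hd
      · have h2 := two_mem_prod hv hw h h' (hs h h')
        obtain ⟨s, hs, s', hs', b, hb, heq⟩ := prod_add_aux hv hw hc hd
        obtain ⟨_, _, hO⟩ := ordering_loc h
        have : c + d = 2 * (((s + s') * 2⁻¹) * b) := by rw [heq]; field_simp
        rw [this]
        refine prod_mul hv hw h2 ⟨_, ?_, b, hb, rfl⟩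
        rw [hO] at *
        rw [abs_mul, abs_of_pos (show (0 : K) < 2⁻¹ by positivity)]
        have := abs_add_le s s'
        linarith
      · rw [prodSet_comm] at *
        exact prod_add_abs hw hv ⟨hinc.2, hinc.1⟩ f hf n hn hc hd
    · exact prod_add_abs hv hw hinc f hf n hn hc hd
  let A : ValuationSubring K :=
    { carrier := prodSet v w
      mul_mem' := fun ha hb => prod_mul hv hw ha hb
      one_mem' := left_sub_prod hw (loc_one hv)
      zero_mem' := left_sub_prod hw (loc_zero hv)
      neg_mem' := fun ha => prod_neg hv ha
      add_mem' := fun ha hb => hadd ha hb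
      mem_or_inv_mem' := by
        intro x
        by_cases hx : x ∈ v
        · exact Or.inl (left_sub_prod hw hx)
        · exact Or.inr (left_sub_prod hw (loc_inv hv hx)) }
  refine ⟨A, rfl, fcc_of_val hv hw hinc A (left_sub_prod hw) (right_sub_prod hv) ?_⟩
  rintro B hvB hwB x ⟨a, ha, b, hb, rfl⟩
  exact mul_mem (hvB ha) (hwB hb)

/-- The basic separation lemma for a pair. -/
lemma pair_sep {v w : Set K} (hv : IsLocality v) (hw : IsLocality w) (hinc : Incomp v w)
    {Bv Bw : Nrm K} (hBv : ∀ x, x ∈ v ↔ Bv.N x ≤ 1) (hBw : ∀ x, x ∈ w ↔ Bw.N x ≤ 1)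
    {c : K} (hc : c ∈ prodSet v w) : ∃ h, Bw.N h < 1 ∧ Bv.N c < Bv.N h := by
  by_contra hcon
  push Not at hcon
  obtain ⟨a, ha, b, hb, rfl⟩ := hc
  rw [hBv] at ha
  rw [hBw] at hb
  -- m_w ⊆ O_v
  have key : ∀ y, Bw.N y < 1 → Bv.N y ≤ 1 := by
    intro y hy
    by_cases hb0 : b = 0
    · have := hcon y hy
      rw [hb0] at this
      simp only [mul_zero, map_zero] at this
      exact this.trans zero_le_one
    have h1 : Bw.N (y * b) < 1 := by
      rw [map_mul]
      exact mul_lt_one_of_lt_of_le hy hb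
    have h2 := hcon _ h1
    rw [map_mul, map_mul] at h2
    have hbp : 0 < Bv.N b := zero_lt_iff.2 (by simpa using hb0)
    exact (le_of_mul_le_mul_right h2 hbp).trans ha
  by_cases hex : ∃ x, Bw.N x < 1 ∧ Bv.N x = 1
  · obtain ⟨x, hx1, hx2⟩ := hex
    apply hinc.2
    intro y hy
    rw [hBw] at hy
    rw [hBv]
    have := key (x * y) (by rw [map_mul]; exact mul_lt_one_of_lt_of_le hx1 hy)
    rwa [map_mul, hx2, one_mul] at this
  · push Not at hex
    apply hinc.1
    intro y hy
    by_contra hyw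
    rw [hBv] at hy
    rw [hBw, not_le] at hyw
    have hi : Bw.N y⁻¹ < 1 := by rw [map_inv₀]; exact inv_lt_one_of_one_lt₀ hyw
    have h1 := key _ hi
    have h2 := lt_of_le_of_ne h1 (hex _ hi)
    rw [map_inv₀] at h2
    have hy0 : 0 < Bv.N y := by
      rw [zero_lt_iff]
      intro h0
      have : y = 0 := by simpa using h0
      rw [this] at hyw; simp at hyw
    have h3 := (inv_lt_one₀ hy0).1 h2
    exact absurd hy (not_le.2 h3)

end
end PaperApprox

namespace PaperApprox
section
universe u
variable {K : Type u} [Field K]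

/-- weak triangle inequality -/
structure Tri (B : Nrm K) (t : K) : Prop where
  t0 : t ≠ 0
  t1 : B.N t ≤ 1
  add : ∀ x y (c : B.Γ), B.N x ≤ c → B.N y ≤ c → B.N t * B.N (x + y) ≤ c

lemma Tri.pos {B : Nrm K} {t : K} (h : Tri B t) : 0 < B.N t :=
  zero_lt_iff.2 (by simpa using h.t0)

lemma Tri.sub {B : Nrm K} {t : K} (h : Tri B t) (x y : K) (c : B.Γ) (hx : B.N x ≤ c)
    (hy : B.N y ≤ c) : B.N t * B.N (x - y) ≤ c := by
  rw [sub_eq_add_neg]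
  exact h.add _ _ _ hx (by rwa [B.N_neg])

/-- norm conditions for f -/
structure Good (B : Nrm K) (t : K) (f : Polynomial K) : Prop extends Tri B t where
  d2 : 2 ≤ f.natDegree
  fi : ∀ x, B.N x ≤ 1 → B.N (f.eval x) ≤ 1
  flow : ∀ x, 1 < B.N x → B.N t * B.N x ^ f.natDegree ≤ B.N (f.eval x)
  fup : ∀ x, 1 < B.N x → B.N (f.eval x) ≤ B.N x ^ f.natDegree
  flead : ∀ x, 1 < B.N x →
    B.N (f.eval x - f.leadingCoeff * x ^ f.natDegree) ≤ B.N x ^ (f.natDegree - 1)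

def Good2 (B : Nrm K) (t : K) (f : Polynomial K) : Prop :=
  ∀ x, B.N x ≤ 1 → B.N t ≤ B.N (f.eval x)

/-- homogenization -/
noncomputable def G (f : Polynomial K) (x y : K) : K := y ^ f.natDegree * f.eval (x / y)

lemma N_pos (B : Nrm K) {x : K} (hx : x ≠ 0) : 0 < B.N x := zero_lt_iff.2 (by simpa using hx)

lemma ne_zero_of_N (B : Nrm K) {x : K} {c : B.Γ} (h : c < B.N x) : x ≠ 0 := by
  rintro rfl
  rw [map_zero] at h
  exact absurd h (not_lt.2 zero_le)

lemma G_up {B : Nrm K} {t : K} {f : Polynomial K} (h : Good B t f) {x y : K} (hy : y ≠ 0)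
    {m : B.Γ} (hx : B.N x ≤ m) (hym : B.N y ≤ m) : B.N (G f x y) ≤ m ^ f.natDegree := by
  rw [G, map_mul, map_pow]
  have hy' := N_pos B hy
  rcases le_or_gt (B.N (x / y)) 1 with h1 | h1
  · calc _ ≤ B.N y ^ f.natDegree * 1 := by gcongr; exact h.fi _ h1
      _ ≤ m ^ f.natDegree := by rw [mul_one]; gcongr
  · calc _ ≤ B.N y ^ f.natDegree * B.N (x / y) ^ f.natDegree := by gcongr; exact h.fup _ h1
      _ = B.N x ^ f.natDegree := by rw [← mul_pow, ← map_mul, mul_div_cancel₀ _ hy]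
      _ ≤ m ^ f.natDegree := by gcongr

lemma G_low {B : Nrm K} {t : K} {f : Polynomial K} (h : Good B t f) (h2 : Good2 B t f)
    {x y : K} (hy : y ≠ 0) : B.N t * B.N x ^ f.natDegree ≤ B.N (G f x y) ∧
      B.N t * B.N y ^ f.natDegree ≤ B.N (G f x y) := by
  rw [G, map_mul, map_pow]
  have hy' := N_pos B hy
  rcases le_or_gt (B.N (x / y)) 1 with h1 | h1
  · have hxy : B.N x ≤ B.N y := by rwa [map_div₀, div_le_one₀ hy'] at h1
    have : B.N t * B.N y ^ f.natDegree ≤ B.N y ^ f.natDegree * B.N (f.eval (x / y)) := by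
      rw [mul_comm]; gcongr; exact h2 _ h1
    refine ⟨le_trans ?_ this, this⟩
    gcongr
  · have hxy : B.N y ≤ B.N x := by
      rw [map_div₀, one_lt_div₀ hy'] at h1; exact h1.le
    have : B.N t * B.N x ^ f.natDegree ≤ B.N y ^ f.natDegree * B.N (f.eval (x / y)) := by
      calc _ = B.N y ^ f.natDegree * (B.N t * B.N (x / y) ^ f.natDegree) := by
            rw [mul_left_comm, ← mul_pow, ← map_mul B.N y, mul_div_cancel₀ _ hy]
        _ ≤ _ := by gcongr; exact h.flow _ h1
    refine ⟨this, le_trans ?_ this⟩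
    gcongr

/-- smallness demand -/
def dem (B : Nrm K) (t : K) (k : ℕ) (b h : K) : Prop :=
  B.N h < B.N t ^ (k + 1) ∧ B.N h < B.N t ^ (k + 1) * B.N b

lemma dem_mono {B : Nrm K} {t : K} {k : ℕ} {b h h' : K} (hd : dem B t k b h)
    (hle : B.N h' ≤ B.N h) : dem B t k b h' :=
  ⟨hle.trans_lt hd.1, hle.trans_lt hd.2⟩

lemma dem_le_one {B : Nrm K} {t : K} (ht : Tri B t) {k : ℕ} {b h : K} (hd : dem B t k b h) :
    B.N h ≤ B.N t := by
  refine hd.1.le.trans ?_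
  rw [pow_succ]
  exact mul_le_of_le_one_left' (pow_le_one' ht.t1 k)

lemma dem_up {B : Nrm K} {t : K} {f : Polynomial K} (h : Good B t f) {k : ℕ} {b x y : K}
    (hy : y ≠ 0) (hx : dem B t k b x) (hyd : dem B t k b y) : dem B t k b (G f x y) := by
  have hd0 : f.natDegree ≠ 0 := by have := h.d2; omega
  rcases le_total (B.N x) (B.N y) with hle | hle
  · refine dem_mono hyd ((G_up h hy hle le_rfl).trans ?_)
    exact pow_le_of_le_one zero_le ((dem_le_one h.toTri hyd).trans h.t1) hd0
  · refine dem_mono hx ((G_up h hy le_rfl hle).trans ?_)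
    exact pow_le_of_le_one zero_le ((dem_le_one h.toTri hx).trans h.t1) hd0

lemma low_aux {B : Nrm K} {t : K} {f : Polynomial K} (h : Good B t f) {k : ℕ} {b x g : K}
    (hx0 : x ≠ 0) (hx : dem B t k b x⁻¹) (hg : B.N t * B.N x ^ f.natDegree ≤ B.N g) :
    dem B t k b g⁻¹ := by
  have hx1 := dem_le_one h.toTri hx
  have hxp := N_pos B hx0
  rw [map_inv₀, inv_le_comm₀ hxp h.toTri.pos] at hx1
  have h1x : 1 ≤ B.N x := le_trans ((one_le_inv₀ h.toTri.pos).2 h.t1) hx1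
  have h1 : 1 ≤ B.N t * B.N x := by
    rwa [inv_le_iff_one_le_mul₀' h.toTri.pos] at hx1
  have hle : B.N x ≤ B.N g := by
    refine le_trans ?_ hg
    obtain ⟨e, he⟩ : ∃ e, f.natDegree = e + 2 := ⟨f.natDegree - 2, by have := h.d2; omega⟩
    rw [he]
    calc B.N x = 1 * (1 * B.N x) := by simp
      _ ≤ (B.N t * B.N x) * (B.N x ^ e * B.N x) := by
        gcongr
        exact one_le_pow₀ h1x
      _ = _ := by rw [pow_add, pow_two]; ac_rfl
  refine dem_mono hx ?_
  rw [map_inv₀, map_inv₀]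
  exact inv_anti₀ hxp hle

lemma dem_low {B : Nrm K} {t : K} {f : Polynomial K} (h : Good B t f) (h2 : Good2 B t f)
    {k : ℕ} {b x y : K} (hx0 : x ≠ 0) (hy0 : y ≠ 0) (hd : dem B t k b x⁻¹ ∨ dem B t k b y⁻¹) :
    dem B t k b (G f x y)⁻¹ := by
  rcases hd with hd | hd
  · exact low_aux h hx0 hd (G_low h h2 hy0).1
  · exact low_aux h hy0 hd (G_low h h2 hy0).2

/-- generic compactness combination -/
lemma compact_comb {X : Type*} [TopologicalSpace X] {H : Type*} {S : Set X} (hS : IsCompact S)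
    (Q : H → Prop) (D : X → H → Prop)
    (hopen : ∀ h, Q h → ∃ U : Set X, IsOpen U ∧ ∀ v ∈ S, v ∈ U ↔ D v h)
    (hcomb : ∀ h1 h2, Q h1 → Q h2 → ∃ h, Q h ∧ ∀ v ∈ S, (D v h1 ∨ D v h2) → D v h)
    (hne : ∃ h, Q h) (hpt : ∀ v ∈ S, ∃ h, Q h ∧ D v h) : ∃ h, Q h ∧ ∀ v ∈ S, D v h := by
  have : ∃ h, Q h ∧ ∀ v ∈ S ∩ S, D v h := by
    refine hS.induction_on (p := fun s => ∃ h, Q h ∧ ∀ v ∈ S ∩ s, D v h) ?_ ?_ ?_ ?_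
    · obtain ⟨h, hh⟩ := hne
      exact ⟨h, hh, by simp⟩
    · rintro s s' hss ⟨h, hh, hD⟩
      exact ⟨h, hh, fun v hv => hD v ⟨hv.1, hss hv.2⟩⟩
    · rintro s s' ⟨h, hh, hD⟩ ⟨h', hh', hD'⟩
      obtain ⟨g, hg, hgD⟩ := hcomb h h' hh hh'
      refine ⟨g, hg, ?_⟩
      rintro v ⟨hv, hv' | hv'⟩
      · exact hgD v hv (Or.inl (hD v ⟨hv, hv'⟩))
      · exact hgD v hv (Or.inr (hD' v ⟨hv, hv'⟩))
    · intro v hv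
      obtain ⟨h, hh, hD⟩ := hpt v hv
      obtain ⟨U, hU, hUD⟩ := hopen h hh
      exact ⟨U, mem_nhdsWithin_of_mem_nhds (hU.mem_nhds ((hUD v hv).2 hD)), h, hh,
        fun w hw => (hUD w hw.1).1 hw.2⟩
  simpa using this

/-- combination over finite sets without condition (ii) -/
lemma finite_comb {ι : Type*} (s : Finset ι) (B : ι → Nrm K) (t : K)
    (htri : ∀ i ∈ s, Tri (B i) t) (A : ι → Set K) (hAt : ∀ i, t⁻¹ ∈ A i)
    (hAm : ∀ i, ∀ a ∈ A i, ∀ b ∈ A i, a * b ∈ A i) (T : ℕ → K → Prop) (hT0 : ∀ k, T k 0)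
    (hT : ∀ k h1 h2, T (k + 1) h1 → T (k + 1) h2 → ∀ m, 1 ≤ m → T k (h1 ^ m + h2))
    (hpt : ∀ i ∈ s, ∀ γ ∈ A i, ∀ k, ∃ h, (B i).N γ < (B i).N h ∧ T k h) :
    ∀ a : ι → K, (∀ i, a i ∈ A i) → ∀ k, ∃ h, T k h ∧ ∀ i ∈ s, (B i).N (a i) < (B i).N h := by
  classical
  induction s using Finset.induction_on with
  | empty => intro a _ k; exact ⟨0, hT0 k, by simp⟩
  | insert i0 s hi0 ih =>
    intro a ha k
    have ih' := ih (fun i hi => htri i (Finset.mem_insert_of_mem hi))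
      (fun i hi => hpt i (Finset.mem_insert_of_mem hi))
    have hmax : ∀ i, ∃ c ∈ A i, (B i).N t⁻¹ ≤ (B i).N c ∧ (B i).N (t⁻¹ * a i) ≤ (B i).N c := by
      intro i
      rcases le_total ((B i).N t⁻¹) ((B i).N (t⁻¹ * a i)) with h | h
      · exact ⟨_, hAm i _ (hAt i) _ (ha i), h, le_rfl⟩
      · exact ⟨_, hAt i, le_rfl, h⟩
    choose a' ha' ha1 ha2 using hmax
    have hApow : ∀ i (n : ℕ), (a' i) ^ (n + 1) ∈ A i := by
      intro i n
      induction n with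
      | zero => simpa using ha' i
      | succ n ihn => rw [pow_succ]; exact hAm i _ ihn _ (ha' i)
    obtain ⟨h1, hTh1, hh1⟩ := ih' a' ha' (k + 1)
    set M := (insert i0 s).card with hM
    obtain ⟨h2, hh2, hTh2⟩ := hpt i0 (Finset.mem_insert_self _ _) (t⁻¹ * (a' i0) ^ (M + 1))
      (hAm _ _ (hAt _) _ (hApow _ _)) (k + 1)
    by_contra hcon
    push Not at hcon
    -- each m has a bad i
    have hbad : ∀ m ∈ Finset.Icc 1 (M + 1), ∃ i ∈ insert i0 s,
        (B i).N (h1 ^ m + h2) ≤ (B i).N (a i) := by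
      intro m hm
      exact hcon _ (hT k h1 h2 hTh1 hTh2 m (Finset.mem_Icc.1 hm).1)
    haveI : Nonempty ι := ⟨i0⟩
    choose! g hg hgb using hbad
    obtain ⟨m, hm, m', hm', hne, hgm⟩ := Finset.exists_ne_map_eq_of_card_lt_of_maps_to
      (s := Finset.Icc 1 (M + 1)) (t := insert i0 s) (by simp [hM]) (f := g) (fun m hm => hg m hm)
    -- two bad exponents
    have key : ∀ i ∈ insert i0 s, ∀ m m' : ℕ, 1 ≤ m' → m' < m → m ≤ M + 1 →
        (B i).N (h1 ^ m + h2) ≤ (B i).N (a i) → (B i).N (h1 ^ m' + h2) ≤ (B i).N (a i) →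
        False := by
      intro i hi m m' hm1 hlt hmM hb hb'
      have tr := htri i hi
      have htinv : 1 ≤ (B i).N t⁻¹ := by rw [map_inv₀]; exact (one_le_inv₀ tr.pos).2 tr.t1
      have ha'1 : 1 ≤ (B i).N (a' i) := htinv.trans (ha1 i)
      rcases lt_or_ge ((B i).N (a' i)) ((B i).N h1) with hlarge | hsmall
      · have hsub := tr.sub _ _ _ hb hb'
        obtain ⟨r, hr, rfl⟩ : ∃ r, 1 ≤ r ∧ m = m' + r := ⟨m - m', by omega, by omega⟩
        have heq : h1 ^ (m' + r) + h2 - (h1 ^ m' + h2) = h1 ^ m' * (h1 ^ r - 1) := by ring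
        rw [heq, map_mul] at hsub
        have h11 : 1 ≤ (B i).N h1 := ha'1.trans hlarge.le
        -- 1 < N (h1^r - 1)
        have hr1 : 1 < (B i).N (h1 ^ r - 1) := by
          by_contra hc
          push Not at hc
          have h3 := tr.add (h1 ^ r - 1) 1 1 hc (by simp)
          rw [sub_add_cancel, map_pow] at h3
          have h4 : (B i).N h1 ≤ (B i).N h1 ^ r := le_self_pow h11 (by omega)
          have h5 : (B i).N t⁻¹ < (B i).N h1 := (ha1 i).trans_lt hlarge
          rw [map_inv₀] at h5
          have h6 : 1 < (B i).N t * (B i).N h1 := by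
            rwa [inv_lt_iff_one_lt_mul₀' tr.pos] at h5
          have h7 : (B i).N t * (B i).N h1 ≤ (B i).N t * (B i).N h1 ^ r := by gcongr
          exact absurd (h6.trans_le (h7.trans h3)) (lt_irrefl _)
        have h3 : (B i).N h1 ≤ (B i).N (h1 ^ m') := by
          rw [map_pow]; exact le_self_pow h11 (by omega)
        have h4 : (B i).N t * (B i).N h1 ≤ (B i).N (a i) := by
          refine le_trans ?_ hsub
          gcongr
          calc (B i).N h1 = (B i).N h1 * 1 := by simp
            _ ≤ _ := by gcongr
        have h5 := (ha2 i).trans_lt hlarge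
        rw [map_mul, map_inv₀, inv_mul_lt_iff₀ tr.pos] at h5
        exact absurd h5 (not_lt.2 h4)
      · have hii : i = i0 := by
          rcases Finset.mem_insert.1 hi with h | h
          · exact h
          · exact absurd (hh1 i h) (not_lt.2 hsmall)
        subst hii
        have h3 : (B i).N (h1 ^ m) ≤ (B i).N (a' i) ^ (M + 1) := by
          rw [map_pow]
          calc _ ≤ (B i).N (a' i) ^ m := by gcongr
            _ ≤ _ := pow_le_pow_right₀ ha'1 hmM
        have h4 : (B i).N (a i) ≤ (B i).N (a' i) ^ (M + 1) := by
          calc (B i).N (a i) ≤ (B i).N (t⁻¹ * a i) := by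
                rw [map_mul]; exact le_mul_of_one_le_left' htinv
            _ ≤ (B i).N (a' i) := ha2 i
            _ ≤ _ := le_self_pow ha'1 (by omega)
        have h5 := tr.sub _ _ _ (hb.trans h4) h3
        rw [add_sub_cancel_left] at h5
        rw [map_mul, map_inv₀, inv_mul_lt_iff₀ tr.pos, map_pow] at hh2
        exact absurd hh2 (not_lt.2 h5)
    rcases lt_or_gt_of_ne hne with hlt | hlt
    · refine key (g m) (hg m hm) m' m (Finset.mem_Icc.1 hm).1 hlt (Finset.mem_Icc.1 hm').2 ?_
        (hgb m hm)
      rw [hgm]; exact hgb m' hm'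
    · refine key (g m) (hg m hm) m m' (Finset.mem_Icc.1 hm').1 hlt (Finset.mem_Icc.1 hm).2
        (hgb m hm) ?_
      rw [hgm]; exact hgb m' hm'

end
end PaperApprox

namespace PaperApprox
section
universe u
variable {K : Type u} [Field K]

lemma natDegree_split {B : Nrm K} {t : K} {f : Polynomial K} (hG : Good B t f) :
    ∃ m, f.natDegree = m + 1 ∧ f.natDegree - 1 = m :=
  ⟨f.natDegree - 1, by have := hG.d2; omega, rfl⟩

lemma lead_le {B : Nrm K} {t : K} {f : Polynomial K} (hG : Good B t f) {x : K} (hx : 1 < B.N x) :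
    B.N t * B.N f.leadingCoeff ≤ 1 := by
  have h0 : 0 < B.N x := zero_lt_one.trans hx
  have h1 := hG.toTri.sub _ _ _ (hG.fup x hx)
    ((hG.flead x hx).trans (pow_le_pow_right₀ hx.le (Nat.sub_le _ 1)))
  rw [sub_sub_cancel, map_mul, map_pow, ← mul_assoc] at h1
  have h2 : (0 : B.Γ) < B.N x ^ f.natDegree := pow_pos h0 _
  exact le_of_mul_le_mul_right (by rwa [one_mul]) h2

lemma f_ne {B : Nrm K} {t : K} {f : Polynomial K} (hG : Good B t f) {p : K} (hp : 1 < B.N p) :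
    f.eval p ≠ 0 := by
  intro h
  have := hG.flow p hp
  rw [h, map_zero] at this
  have h2 : (0 : B.Γ) < B.N t * B.N p ^ f.natDegree :=
    mul_pos hG.toTri.pos (pow_pos (zero_lt_one.trans hp) _)
  exact absurd this (not_le.2 h2)

/-- the approximating element -/
noncomputable def eElt (f : Polynomial K) (h p : K) : K :=
  f.leadingCoeff * h * p ^ (f.natDegree - 1) / f.eval p

lemma e_ratio {B : Nrm K} {t : K} {f : Polynomial K} (hG : Good B t f) {h p : K}
    (hp : 1 < B.N p) : B.N t ^ 2 * B.N (eElt f h p) * B.N p ≤ B.N h := by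
  obtain ⟨m, hm, hm1⟩ := natDegree_split hG
  have h0 : 0 < B.N p := zero_lt_one.trans hp
  have h2 : (0 : B.Γ) < B.N p ^ m := pow_pos h0 _
  have hf := f_ne hG hp
  have heq : B.N (eElt f h p) * B.N (f.eval p) = B.N f.leadingCoeff * B.N h * B.N p ^ m := by
    rw [← map_mul, eElt, div_mul_cancel₀ _ hf, map_mul, map_mul, map_pow, hm1]
  refine le_of_mul_le_mul_right ?_ h2
  calc B.N t ^ 2 * B.N (eElt f h p) * B.N p * B.N p ^ m
      = B.N t * (B.N (eElt f h p) * (B.N t * B.N p ^ f.natDegree)) := by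
        rw [hm, pow_succ _ m, pow_two]; ac_rfl
    _ ≤ B.N t * (B.N (eElt f h p) * B.N (f.eval p)) := by
        gcongr; exact hG.flow p hp
    _ = (B.N t * B.N f.leadingCoeff) * (B.N h * B.N p ^ m) := by rw [heq]; ac_rfl
    _ ≤ 1 * (B.N h * B.N p ^ m) := by gcongr; exact lead_le hG hp
    _ = _ := by rw [one_mul]

lemma dem_lt {B : Nrm K} {t : K} (ht : Tri B t) {k : ℕ} {b h : K} (hd : dem B t k b h) :
    B.N h < 1 ∧ B.N h < B.N b := by
  have h1 : B.N t ^ (k + 1) ≤ 1 := pow_le_one' ht.t1 _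
  exact ⟨hd.1.trans_le h1, hd.2.trans_le (mul_le_of_le_one_left' h1)⟩

lemma S_est {B : Nrm K} {t : K} {f : Polynomial K} (hG : Good B t f) {b h q : K} (hh : h ≠ 0)
    (h1 : dem B t 3 b h⁻¹) (h2 : dem B t 3 b q) :
    B.N (eElt f h (h * (1 + q)) - 1) < B.N b := by
  obtain ⟨m, hm, hm1⟩ := natDegree_split hG
  have tp := hG.toTri.pos
  have hH := N_pos B hh
  obtain ⟨c, hc1, hc2, hcb⟩ : ∃ c, B.N h⁻¹ ≤ c ∧ B.N q ≤ c ∧ c < B.N t ^ 4 * B.N b :=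
    ⟨max (B.N h⁻¹) (B.N q), le_max_left _ _, le_max_right _ _, max_lt h1.2 h2.2⟩
  have ht4 : B.N t ^ 4 ≤ B.N t := pow_le_of_le_one zero_le hG.t1 (by norm_num)
  have hq : B.N t ≤ B.N (1 + q) := by
    by_contra hcon
    push Not at hcon
    obtain ⟨d, hd1, hd2, hd⟩ : ∃ d, B.N (1 + q) ≤ d ∧ B.N q ≤ d ∧ d < B.N t :=
      ⟨max (B.N (1 + q)) (B.N q), le_max_left _ _, le_max_right _ _,
        max_lt hcon (h2.1.trans_le ht4)⟩
    have := hG.toTri.sub _ _ _ hd1 hd2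
    rw [add_sub_cancel_right, map_one, mul_one] at this
    exact absurd hd (not_lt.2 this)
  set p := h * (1 + q) with hp
  have hPH : B.N t * B.N h ≤ B.N p := by
    rw [hp, map_mul, mul_comm]; gcongr
  have hP1 : 1 < B.N p := by
    refine lt_of_lt_of_le ?_ hPH
    have h3 : B.N h⁻¹ < B.N t := h1.1.trans_le ht4
    rw [map_inv₀, inv_lt_iff_one_lt_mul₀ hH] at h3
    exact h3
  have hP0 : 0 < B.N p := zero_lt_one.trans hP1
  have hL := lead_le hG hP1
  have hf := f_ne hG hP1
  set δ := f.eval p - f.leadingCoeff * p ^ f.natDegree with hδ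
  have hδN := hG.flead p hP1
  rw [hm1] at hδN
  set y := f.leadingCoeff * p ^ m * h * q with hy
  have heq : (eElt f h p - 1) * f.eval p = -(y + δ) := by
    rw [eElt, sub_mul, div_mul_cancel₀ _ hf, hδ, hy, hm1, hm, pow_succ, hp]
    ring
  have hu : B.N (t ^ 2 * y) ≤ B.N p ^ (m + 1) * c := by
    calc B.N (t ^ 2 * y) = (B.N t * B.N f.leadingCoeff) * (B.N t * B.N h) * B.N p ^ m * B.N q := by
          rw [hy]; simp only [map_mul, map_pow]; rw [pow_two]; ac_rfl
      _ ≤ 1 * B.N p * B.N p ^ m * c := by gcongr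
      _ = _ := by rw [one_mul, pow_succ]; ac_rfl
  have hd : B.N (t ^ 2 * δ) ≤ B.N p ^ (m + 1) * c := by
    have h5 : B.N t ≤ B.N p * c := by
      calc B.N t = (B.N t * B.N h) * B.N h⁻¹ := by
            rw [mul_assoc, ← map_mul, mul_inv_cancel₀ hh, map_one, mul_one]
        _ ≤ _ := by gcongr
    calc B.N (t ^ 2 * δ) = B.N t ^ 2 * B.N δ := by rw [map_mul, map_pow]
      _ ≤ B.N t * B.N p ^ m := by
        gcongr
        exact pow_le_of_le_one zero_le hG.t1 (by norm_num)
      _ ≤ (B.N p * c) * B.N p ^ m := by gcongr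
      _ = _ := by rw [pow_succ]; ac_rfl
  have hsum := hG.add _ _ _ hu hd
  rw [← mul_add, map_mul, map_pow, ← B.N_neg (y + δ), ← heq, map_mul] at hsum
  have hP : (0 : B.Γ) < B.N p ^ (m + 1) := pow_pos hP0 _
  have hfin : B.N t ^ 4 * B.N (eElt f h p - 1) ≤ c := by
    refine le_of_mul_le_mul_left ?_ hP
    refine le_trans ?_ hsum
    calc B.N p ^ (m + 1) * (B.N t ^ 4 * B.N (eElt f h p - 1))
        = B.N t * (B.N t ^ 2 * (B.N (eElt f h p - 1) * (B.N t * B.N p ^ f.natDegree))) := by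
          rw [hm, show (4 : ℕ) = 2 + 1 + 1 from rfl, pow_succ (B.N t), pow_succ (B.N t)]; ac_rfl
      _ ≤ _ := by gcongr; exact hG.flow p hP1
  have := hfin.trans_lt hcb
  exact lt_of_mul_lt_mul_left this zero_le

lemma T_est {B : Nrm K} {t : K} {f : Polynomial K} (hG : Good B t f) (hG2 : Good2 B t f)
    {b h : K} (hh : h ≠ 0) (h1 : dem B t 3 b h) (p : K) : B.N (eElt f h p) < B.N b := by
  have tp := hG.toTri.pos
  have hH := N_pos B hh
  have ht4 : B.N t ^ 4 ≤ B.N t ^ 2 := pow_le_pow_right_of_le_one' hG.t1 (by norm_num)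
  have key : B.N t ^ 2 * B.N (eElt f h p) ≤ B.N h := by
    rcases lt_or_ge 1 (B.N p) with hp | hp
    · refine le_trans ?_ (e_ratio hG hp)
      exact le_mul_of_one_le_right' hp.le
    · have hL : B.N t * B.N f.leadingCoeff ≤ 1 := by
        refine lead_le hG (x := h⁻¹) ?_
        rw [map_inv₀]
        exact (one_lt_inv₀ hH).2 (dem_lt hG.toTri h1).1
      have hft := hG2 p hp
      have hf : f.eval p ≠ 0 := ne_zero_of_N B (tp.trans_le hft)
      have heq : B.N (eElt f h p) * B.N (f.eval p) =
          B.N f.leadingCoeff * B.N h * B.N p ^ (f.natDegree - 1) := by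
        rw [← map_mul, eElt, div_mul_cancel₀ _ hf, map_mul, map_mul, map_pow]
      calc B.N t ^ 2 * B.N (eElt f h p) = B.N t * (B.N (eElt f h p) * B.N t) := by
            rw [pow_two]; ac_rfl
        _ ≤ B.N t * (B.N (eElt f h p) * B.N (f.eval p)) := by gcongr
        _ = (B.N t * B.N f.leadingCoeff) * B.N h * B.N p ^ (f.natDegree - 1) := by
            rw [heq]; ac_rfl
        _ ≤ 1 * B.N h * 1 := by gcongr; exact pow_le_one' hp _
        _ = _ := by simp
  have h3 : B.N t ^ 2 * B.N (eElt f h p) < B.N t ^ 2 * B.N b := by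
    refine key.trans_lt (h1.2.trans_le ?_)
    gcongr
  exact lt_of_mul_lt_mul_left h3 zero_le

lemma E_est {B : Nrm K} {t : K} {f : Polynomial K} (hG : Good B t f)
    {b h q : K} (hh : h ≠ 0) (hq0 : q ≠ 0) (h1 : dem B t 3 b q⁻¹) (h2 : dem B t 3 h q⁻¹) :
    B.N (eElt f h (h * (1 + q))) < B.N b := by
  have tp := hG.toTri.pos
  have hH := N_pos B hh
  have hQ := N_pos B hq0
  have ht3 : B.N t ^ 4 ≤ B.N t := pow_le_of_le_one zero_le hG.t1 (by norm_num)
  have ht43 : B.N t ^ 4 ≤ B.N t ^ 3 := pow_le_pow_right_of_le_one' hG.t1 (by norm_num)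
  have hq : B.N t * B.N q ≤ B.N (1 + q) := by
    by_contra hcon
    push Not at hcon
    have h3 : B.N q⁻¹ < B.N t := h1.1.trans_le ht3
    rw [map_inv₀, inv_lt_iff_one_lt_mul₀ hQ] at h3
    obtain ⟨d, hd1, hd2, hd⟩ : ∃ d, B.N (1 + q) ≤ d ∧ B.N 1 ≤ d ∧ d < B.N t * B.N q :=
      ⟨max (B.N (1 + q)) (B.N 1), le_max_left _ _, le_max_right _ _,
        max_lt hcon (by rw [map_one]; exact h3)⟩
    have := hG.toTri.sub _ _ _ hd1 hd2
    rw [add_sub_cancel_left] at this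
    exact absurd hd (not_lt.2 this)
  set p := h * (1 + q) with hp
  have hPH : B.N t * (B.N h * B.N q) ≤ B.N p := by
    rw [hp, map_mul, mul_left_comm]; gcongr
  have hP1 : 1 < B.N p := by
    refine lt_of_lt_of_le ?_ hPH
    have h3 : B.N q⁻¹ < B.N t * B.N h := by
      refine h2.2.trans_le ?_
      gcongr
    rw [map_inv₀, inv_lt_iff_one_lt_mul₀ hQ] at h3
    rwa [← mul_assoc]
  have h3 := e_ratio (h := h) hG hP1
  have hcan : 0 < B.N h * B.N q := mul_pos hH hQ
  have key : B.N t ^ 3 * B.N (eElt f h p) ≤ B.N q⁻¹ := by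
    refine le_of_mul_le_mul_right ?_ hcan
    calc B.N t ^ 3 * B.N (eElt f h p) * (B.N h * B.N q)
        = B.N t ^ 2 * B.N (eElt f h p) * (B.N t * (B.N h * B.N q)) := by
          rw [pow_succ (B.N t) 2]; ac_rfl
      _ ≤ B.N t ^ 2 * B.N (eElt f h p) * B.N p := by gcongr
      _ ≤ B.N h := h3
      _ = B.N q⁻¹ * (B.N h * B.N q) := by
          rw [mul_left_comm, ← map_mul B.N q⁻¹, inv_mul_cancel₀ hq0, map_one, mul_one]
  have h4 : B.N t ^ 3 * B.N (eElt f h p) < B.N t ^ 3 * B.N b := by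
    refine key.trans_lt (h1.2.trans_le ?_)
    gcongr
  exact lt_of_mul_lt_mul_left h4 zero_le

end
end PaperApprox

namespace PaperApprox
section
universe u
variable {K : Type u} [Field K]

/-- independence data for a pair of norms -/
structure PairInd (Bv Bw : Nrm K) (R : ValuationSubring K) (t : K) : Prop where
  subv : ∀ x, Bv.N x ≤ 1 → x ∈ R
  subw : ∀ x, Bw.N x ≤ 1 → x ∈ R
  tm : t ∈ R
  tinv : t⁻¹ ∈ R
  sep : ∀ c ∈ R, ∃ h, Bw.N h < 1 ∧ Bv.N c < Bv.N h

/-- a single element realizing a demand -/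
lemma dem_elt (B : Nrm K) {t : K} (ht : t ≠ 0) (k : ℕ) {b : K} (hb : b ≠ 0) :
    ∃ β : K, β ≠ 0 ∧ (β = t ^ (k + 1) ∨ β = t ^ (k + 1) * b) ∧
      ∀ h, B.N h < B.N β → dem B t k b h := by
  have h0 : t ^ (k + 1) ≠ 0 := pow_ne_zero _ ht
  rcases le_total (B.N (t ^ (k + 1))) (B.N (t ^ (k + 1) * b)) with hle | hle
  · refine ⟨_, h0, Or.inl rfl, fun h hh => ⟨?_, ?_⟩⟩
    · rwa [← map_pow]
    · rw [← map_pow, ← map_mul]; exact hh.trans_le hle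
  · refine ⟨_, mul_ne_zero h0 hb, Or.inr rfl, fun h hh => ⟨?_, ?_⟩⟩
    · rw [← map_pow]; exact hh.trans_le hle
    · rwa [← map_pow, ← map_mul]

lemma dem_elt_inv {A : Set K} {t b β : K} {k : ℕ} (hAt : t⁻¹ ∈ A)
    (hAm : ∀ a ∈ A, ∀ b ∈ A, a * b ∈ A) (hb : b⁻¹ ∈ A)
    (hβ : β = t ^ (k + 1) ∨ β = t ^ (k + 1) * b) : β⁻¹ ∈ A := by
  have hp : ∀ n : ℕ, (t⁻¹) ^ (n + 1) ∈ A := by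
    intro n
    induction n with
    | zero => simpa using hAt
    | succ n ih => rw [pow_succ]; exact hAm _ ih _ hAt
  rcases hβ with rfl | rfl
  · rw [← inv_pow]; exact hp k
  · rw [mul_inv, ← inv_pow]; exact hAm _ (hp k) _ hb

lemma pair_dem {Bv Bw : Nrm K} {R : ValuationSubring K} {t : K} (ht : t ≠ 0)
    (hP : PairInd Bv Bw R t) (k : ℕ) {bv bw : K} (hbv : bv ≠ 0) (hbw : bw ≠ 0)
    (hv : bv⁻¹ ∈ R) (hw : bw⁻¹ ∈ R) :
    ∃ h, h ≠ 0 ∧ dem Bv t k bv h⁻¹ ∧ dem Bw t k bw h := by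
  obtain ⟨β, hβ0, hβ, hβd⟩ := dem_elt Bw ht k hbw
  obtain ⟨β', hβ0', hβ', hβd'⟩ := dem_elt Bv ht k hbv
  have hR : β⁻¹ ∈ (R : Set K) := dem_elt_inv hP.tinv (fun a ha b hb => R.mul_mem _ _ ha hb) hw hβ
  have hR' : β'⁻¹ ∈ (R : Set K) :=
    dem_elt_inv hP.tinv (fun a ha b hb => R.mul_mem _ _ ha hb) hv hβ'
  obtain ⟨h, h1, h2⟩ := hP.sep _ (R.mul_mem _ _ hR' hR)
  have hh : h ≠ 0 := ne_zero_of_N _ h2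
  refine ⟨h * β, mul_ne_zero hh hβ0, hβd' _ ?_, hβd _ ?_⟩
  · rw [map_inv₀, inv_lt_comm₀ (N_pos _ (mul_ne_zero hh hβ0)) (N_pos _ hβ0'), ← map_inv₀]
    calc Bv.N β'⁻¹ = Bv.N (β'⁻¹ * β⁻¹) * Bv.N β := by
          rw [← map_mul, mul_assoc, inv_mul_cancel₀ hβ0, mul_one]
      _ < Bv.N h * Bv.N β := mul_lt_mul_of_pos_right h2 (N_pos _ hβ0)
      _ = _ := by rw [map_mul]
  · rw [map_mul]
    calc Bw.N h * Bw.N β < 1 * Bw.N β := mul_lt_mul_of_pos_right h1 (N_pos _ hβ0)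
      _ = _ := one_mul _

lemma dem_T0 {B : Nrm K} {t : K} (ht : t ≠ 0) (k : ℕ) {b : K} (hb : b ≠ 0) : dem B t k b 0 := by
  have h1 : (0 : B.Γ) < B.N t ^ (k + 1) := pow_pos (N_pos B ht) _
  exact ⟨by rwa [map_zero], by rw [map_zero]; exact mul_pos h1 (N_pos B hb)⟩

lemma dem_T {B : Nrm K} {t : K} (ht : Tri B t) (k : ℕ) {b h1 h2 : K}
    (hd1 : dem B t (k + 1) b h1) (hd2 : dem B t (k + 1) b h2) (m : ℕ) (hm : 1 ≤ m) :
    dem B t k b (h1 ^ m + h2) := by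
  have h3 : B.N (h1 ^ m) ≤ B.N h1 := by
    rw [map_pow]
    exact pow_le_of_le_one zero_le (dem_lt ht hd1).1.le (by omega)
  have h4 := ht.add (h1 ^ m) h2 (max (B.N h1) (B.N h2)) (h3.trans (le_max_left _ _))
    (le_max_right _ _)
  constructor
  · have h5 := h4.trans_lt (max_lt hd1.1 hd2.1)
    rw [pow_succ' _ (k + 1)] at h5
    exact lt_of_mul_lt_mul_left h5 zero_le
  · have h5 := h4.trans_lt (max_lt hd1.2 hd2.2)
    rw [pow_succ' _ (k + 1), mul_assoc] at h5
    exact lt_of_mul_lt_mul_left h5 zero_le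

lemma fin_up {ι : Type*} (V : Finset ι) (B : ι → Nrm K) (t : K) (ht : t ≠ 0)
    (htri : ∀ i ∈ V, Tri (B i) t) (A : ι → Set K) (hAt : ∀ i ∈ V, t⁻¹ ∈ A i)
    (hA1 : ∀ i ∈ V, 1 ∈ A i)
    (hAm : ∀ i ∈ V, ∀ a ∈ A i, ∀ b ∈ A i, a * b ∈ A i) (T : ℕ → K → Prop) (hT0 : ∀ k, T k 0)
    (hT : ∀ k h1 h2, T (k + 1) h1 → T (k + 1) h2 → ∀ m, 1 ≤ m → T k (h1 ^ m + h2))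
    (hpt : ∀ i ∈ V, ∀ b : K, b ≠ 0 → b⁻¹ ∈ A i → ∀ k, ∃ h, h ≠ 0 ∧ dem (B i) t k b h⁻¹ ∧ T k h)
    (b : ι → K) (hb0 : ∀ i ∈ V, b i ≠ 0) (hb : ∀ i ∈ V, (b i)⁻¹ ∈ A i) (k : ℕ) :
    ∃ h, T k h ∧ ∀ i ∈ V, h ≠ 0 ∧ dem (B i) t k (b i) h⁻¹ := by
  have hex : ∀ i, ∃ a, i ∈ V → a ∈ A i ∧
      ∀ h, (B i).N a < (B i).N h → h ≠ 0 ∧ dem (B i) t k (b i) h⁻¹ := by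
    intro i
    by_cases hi : i ∈ V
    · obtain ⟨β, hβ0, hβ, hβd⟩ := dem_elt (B i) ht k (hb0 i hi)
      refine ⟨β⁻¹, fun _ => ⟨dem_elt_inv (hAt i hi) (hAm i hi) (hb i hi) hβ, fun h hh => ?_⟩⟩
      have h0 := ne_zero_of_N _ hh
      refine ⟨h0, hβd _ ?_⟩
      rw [map_inv₀] at hh ⊢
      rwa [inv_lt_comm₀ (N_pos _ h0) (N_pos _ hβ0)]
    · exact ⟨0, fun h => absurd h hi⟩
  choose a ha using hex
  obtain ⟨h, hTh, hh⟩ := finite_comb V B t htri (fun i => {γ | i ∈ V → γ ∈ A i})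
    (fun i hi => hAt i hi) (fun i a ha b hb hi => hAm i hi _ (ha hi) _ (hb hi)) T hT0 hT
    (by
      intro i hi γ hγ k
      by_cases hγ0 : γ = 0
      · obtain ⟨h, h0, -, hTh⟩ := hpt i hi 1 one_ne_zero (by rw [inv_one]; exact hA1 i hi) k
        exact ⟨h, by rw [hγ0, map_zero]; exact N_pos _ h0, hTh⟩
      · obtain ⟨h, h0, hd, hTh⟩ := hpt i hi γ⁻¹ (inv_ne_zero hγ0)
          (by rw [inv_inv]; exact hγ hi) k
        refine ⟨h, ?_, hTh⟩
        have := (dem_lt (htri i hi) hd).2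
        rwa [map_inv₀, map_inv₀, inv_lt_inv₀ (N_pos _ h0) (N_pos _ hγ0)] at this)
    a (fun i hi => (ha i hi).1) k
  exact ⟨h, hTh, fun i hi => (ha i hi).2 h (hh i hi)⟩

/-- the standing data -/
structure Data {n : ℕ} (S : Fin n → Set (Set K)) (t : K) (f : Polynomial K)
    (B : Set K → Nrm K) (R : Set K → Set K → ValuationSubring K) : Prop where
  t0 : t ≠ 0
  good : ∀ i, ∀ v ∈ S i, Good (B v) t f
  good2 : ∀ i, (S i).Infinite → ∀ v ∈ S i, Good2 (B v) t f
  comp : ∀ i, @IsCompact (Set K) (zarStarTop K) (S i)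
  opn : ∀ k b h, b ≠ 0 → ∃ U : Set (Set K), @IsOpen _ (zarStarTop K) U ∧
    ∀ i, ∀ v ∈ S i, v ∈ U ↔ dem (B v) t k b h
  pair : ∀ i j, i ≠ j → ∀ v ∈ S i, ∀ w ∈ S j, PairInd (B v) (B w) (R v w) t
  pair' : ∀ i j, i ≠ j → ∀ v ∈ S i, ∀ w ∈ S j, PairInd (B w) (B v) (R v w) t

section
variable {n : ℕ} {S : Fin n → Set (Set K)} {t : K} {f : Polynomial K}
    {B : Set K → Nrm K} {R : Set K → Set K → ValuationSubring K}

lemma G_ne (D : Data S t f B R) {i : Fin n} (hi : (S i).Infinite) {x y : K} (hy : y ≠ 0) :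
    G f x y ≠ 0 := by
  obtain ⟨v, hv⟩ := hi.nonempty
  have hg := D.good i v hv
  refine mul_ne_zero (pow_ne_zero _ hy) ?_
  rcases lt_or_ge 1 ((B v).N (x / y)) with h | h
  · exact f_ne hg h
  · exact ne_zero_of_N (B v) (hg.toTri.pos.trans_le (D.good2 i hi v hv _ h))

lemma stepA1 (D : Data S t f B R) {i j : Fin n} (hij : j ≠ i) (hi : (S i).Infinite) (k : ℕ)
    {v : Set K} (hv : v ∈ S j) {bv bi : K} (hbv : bv ≠ 0) (hbi : bi ≠ 0)
    (h1 : ∀ w ∈ S i, bv⁻¹ ∈ R v w) (h2 : ∀ w ∈ S i, bi⁻¹ ∈ R v w) :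
    ∃ h, (h ≠ 0 ∧ dem (B v) t k bv h⁻¹) ∧ ∀ w ∈ S i, dem (B w) t k bi h := by
  letI := zarStarTop K
  have hpt : ∀ w ∈ S i, ∃ h, (h ≠ 0 ∧ dem (B v) t k bv h⁻¹) ∧ dem (B w) t k bi h := by
    intro w hw
    obtain ⟨h, h0, hd, hd'⟩ := pair_dem D.t0 (D.pair j i hij v hv w hw) k hbv hbi (h1 w hw) (h2 w hw)
    exact ⟨h, ⟨h0, hd⟩, hd'⟩
  refine compact_comb (D.comp i) (fun h => h ≠ 0 ∧ dem (B v) t k bv h⁻¹)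
    (fun w h => dem (B w) t k bi h) ?_ ?_ ?_ hpt
  · intro h _
    obtain ⟨U, hU, hUD⟩ := D.opn k bi h hbi
    exact ⟨U, hU, hUD i⟩
  · rintro a c ⟨ha0, ha⟩ ⟨hc0, hc⟩
    refine ⟨(G f a⁻¹ c⁻¹)⁻¹, ⟨inv_ne_zero (G_ne D hi (inv_ne_zero hc0)), ?_⟩, ?_⟩
    · rw [inv_inv]; exact dem_up (D.good j v hv) (inv_ne_zero hc0) ha hc
    · intro w hw hd
      exact dem_low (D.good i w hw) (D.good2 i hi w hw) (inv_ne_zero ha0) (inv_ne_zero hc0)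
        (by simpa using hd)
  · obtain ⟨w, hw⟩ := hi.nonempty
    obtain ⟨h, hQ, _⟩ := hpt w hw
    exact ⟨h, hQ⟩

lemma stepA2 (D : Data S t f B R) {j : Fin n} (J : Finset (Fin n)) (hJ : j ∉ J)
    (hinf : ∀ i ∈ J, (S i).Infinite) (k : ℕ)
    {v : Set K} (hv : v ∈ S j) {bv : K} {b : Fin n → K} (hbv : bv ≠ 0) (hbi : ∀ i, b i ≠ 0)
    (h1 : ∀ i ∈ J, ∀ w ∈ S i, bv⁻¹ ∈ R v w) (h2 : ∀ i ∈ J, ∀ w ∈ S i, (b i)⁻¹ ∈ R v w)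
    (hbase : ∃ h, h ≠ 0 ∧ dem (B v) t k bv h⁻¹) :
    ∃ h, (h ≠ 0 ∧ dem (B v) t k bv h⁻¹) ∧ ∀ i ∈ J, ∀ w ∈ S i, dem (B w) t k (b i) h := by
  induction J using Finset.induction_on with
  | empty => obtain ⟨h, hh⟩ := hbase; exact ⟨h, hh, by simp⟩
  | insert i J hiJ ih =>
    obtain ⟨a, ⟨ha0, ha⟩, haD⟩ := ih (fun h => hJ (Finset.mem_insert_of_mem h))
      (fun l hl => hinf l (Finset.mem_insert_of_mem hl))
      (fun l hl => h1 l (Finset.mem_insert_of_mem hl))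
      (fun l hl => h2 l (Finset.mem_insert_of_mem hl))
    have him := Finset.mem_insert_self i J
    have hi := hinf i him
    obtain ⟨c, ⟨hc0, hc⟩, hcD⟩ := stepA1 D (i := i) (j := j) (by rintro rfl; exact hJ him)
      hi k hv hbv (hbi i) (h1 i him) (h2 i him)
    refine ⟨(G f a⁻¹ c⁻¹)⁻¹, ⟨inv_ne_zero (G_ne D hi (inv_ne_zero hc0)), ?_⟩, ?_⟩
    · rw [inv_inv]; exact dem_up (D.good j v hv) (inv_ne_zero hc0) ha hc
    · intro l hl w hw
      refine dem_low (D.good l w hw) (D.good2 l (hinf l hl) w hw) (inv_ne_zero ha0)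
        (inv_ne_zero hc0) ?_
      rw [inv_inv, inv_inv]
      rcases Finset.mem_insert.1 hl with rfl | hl
      · exact Or.inr (hcD w hw)
      · exact Or.inl (haD l hl w hw)

lemma stepA (D : Data S t f B R) {j : Fin n} (J : Finset (Fin n)) (hJ : j ∉ J)
    (hinf : ∀ i ∈ J, (S i).Infinite) (hne : (S j).Nonempty) (k : ℕ)
    {b : Fin n → K} (hb0 : ∀ i, b i ≠ 0)
    (h1 : ∀ v ∈ S j, ∀ i ∈ J, ∀ w ∈ S i, (b j)⁻¹ ∈ R v w)
    (h2 : ∀ v ∈ S j, ∀ i ∈ J, ∀ w ∈ S i, (b i)⁻¹ ∈ R v w)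
    (l : Fin n) (hlj : j ≠ l) (hl : (S l).Nonempty) (h3 : ∀ v ∈ S j, ∀ w ∈ S l, (b j)⁻¹ ∈ R v w) :
    ∃ h, h ≠ 0 ∧ (∀ v ∈ S j, dem (B v) t k (b j) h⁻¹) ∧
      ∀ i ∈ J, ∀ w ∈ S i, dem (B w) t k (b i) h := by
  classical
  letI := zarStarTop K
  obtain ⟨w0, hw0⟩ := hl
  have hbase : ∀ v ∈ S j, ∀ k, ∀ bv : K, bv ≠ 0 → bv⁻¹ ∈ R v w0 →
      ∃ h, h ≠ 0 ∧ dem (B v) t k bv h⁻¹ := by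
    intro v hv k bv hbv hR
    obtain ⟨h, h0, hd, -⟩ := pair_dem D.t0 (D.pair j l hlj v hv w0 hw0) k hbv one_ne_zero hR
      (by rw [inv_one]; exact one_mem _)
    exact ⟨h, h0, hd⟩
  by_cases hj : (S j).Infinite
  · have hpt : ∀ v ∈ S j, ∃ h, (h ≠ 0 ∧ ∀ i ∈ J, ∀ w ∈ S i, dem (B w) t k (b i) h) ∧
        dem (B v) t k (b j) h⁻¹ := by
      intro v hv
      obtain ⟨h, ⟨h0, hd⟩, hD⟩ := stepA2 D J hJ hinf k hv (hb0 j) hb0 (h1 v hv) (h2 v hv)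
        (hbase v hv k _ (hb0 j) (h3 v hv w0 hw0))
      exact ⟨h, ⟨h0, hD⟩, hd⟩
    obtain ⟨h, ⟨h0, hh⟩, hD⟩ := compact_comb (D.comp j)
      (fun h => h ≠ 0 ∧ ∀ i ∈ J, ∀ w ∈ S i, dem (B w) t k (b i) h)
      (fun v h => dem (B v) t k (b j) h⁻¹) (by
        intro h _
        obtain ⟨U, hU, hUD⟩ := D.opn k (b j) h⁻¹ (hb0 j)
        exact ⟨U, hU, hUD j⟩) (by
        rintro a c ⟨ha0, ha⟩ ⟨hc0, hc⟩
        refine ⟨G f a c, ⟨G_ne D hj hc0, fun i hi w hw => ?_⟩, fun v hv hd => ?_⟩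
        · exact dem_up (D.good i w hw) hc0 (ha i hi w hw) (hc i hi w hw)
        · exact dem_low (D.good j v hv) (D.good2 j hj v hv) ha0 hc0 hd) (by
        obtain ⟨v, hv⟩ := hne
        obtain ⟨h, hQ, _⟩ := hpt v hv
        exact ⟨h, hQ⟩) hpt
    exact ⟨h, h0, hD, hh⟩
  · rw [Set.not_infinite] at hj
    obtain ⟨h, hT, hh⟩ := fin_up hj.toFinset B t D.t0
      (fun v hv => (D.good j v (hj.mem_toFinset.1 hv)).toTri)
      (fun v => {γ | γ ∈ R v w0 ∧ ∀ i ∈ J, ∀ w ∈ S i, γ ∈ R v w})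
      (fun v hv => ⟨(D.pair j l hlj v (hj.mem_toFinset.1 hv) w0 hw0).tinv, fun i hi w hw =>
        (D.pair j i (by rintro rfl; exact hJ hi) v (hj.mem_toFinset.1 hv) w hw).tinv⟩)
      (fun v _ => ⟨one_mem _, fun i hi w hw => one_mem _⟩)
      (fun v _ a ha c hc => ⟨mul_mem ha.1 hc.1, fun i hi w hw =>
        mul_mem (ha.2 i hi w hw) (hc.2 i hi w hw)⟩)
      (fun k h => ∀ i ∈ J, ∀ w ∈ S i, dem (B w) t k (b i) h)
      (fun k i _ w _ => dem_T0 D.t0 k (hb0 i))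
      (fun k a c ha hc m hm i hi w hw => dem_T (D.good i w hw).toTri k (ha i hi w hw)
        (hc i hi w hw) m hm)
      (by
        intro v hv β hβ0 hβ k
        have hv' := hj.mem_toFinset.1 hv
        obtain ⟨h, ⟨h0, hd⟩, hD⟩ := stepA2 D J hJ hinf k hv' hβ0 hb0 hβ.2 (h2 v hv')
          (hbase v hv' k _ hβ0 hβ.1)
        exact ⟨h, h0, hd, hD⟩)
      (fun _ => b j) (fun _ _ => hb0 j)
      (fun v hv => ⟨h3 v (hj.mem_toFinset.1 hv) w0 hw0, h1 v (hj.mem_toFinset.1 hv)⟩) k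
    obtain ⟨v0, hv0⟩ := hne
    exact ⟨h, (hh v0 (hj.mem_toFinset.2 hv0)).1,
      fun v hv => (hh v (hj.mem_toFinset.2 hv)).2, hT⟩

/-- finite versus finite -/
lemma stepB {ι κ : Type*} (V : Finset ι) (W : Finset κ) (hV : V.Nonempty)
    (Bv : ι → Nrm K) (Bw : κ → Nrm K) (Q : ι → κ → ValuationSubring K) (ht : t ≠ 0)
    (hv : ∀ i ∈ V, Tri (Bv i) t) (hw : ∀ i ∈ W, Tri (Bw i) t)
    (hP : ∀ i ∈ V, ∀ l ∈ W, PairInd (Bv i) (Bw l) (Q i l) t)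
    (hP' : ∀ i ∈ V, ∀ l ∈ W, PairInd (Bw l) (Bv i) (Q i l) t) (hW : W.Nonempty)
    (bv : ι → K) (bw : κ → K) (hbv0 : ∀ i ∈ V, bv i ≠ 0) (hbw0 : ∀ l ∈ W, bw l ≠ 0)
    (hbv : ∀ i ∈ V, ∀ l ∈ W, (bv i)⁻¹ ∈ Q i l) (hbw : ∀ i ∈ V, ∀ l ∈ W, (bw l)⁻¹ ∈ Q i l)
    (k : ℕ) :
    ∃ h, h ≠ 0 ∧ (∀ i ∈ V, dem (Bv i) t k (bv i) h⁻¹) ∧ ∀ l ∈ W, dem (Bw l) t k (bw l) h := by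
  -- first fix one place on the left
  have hfix : ∀ i ∈ V, ∀ b : K, b ≠ 0 → (∀ l ∈ W, b⁻¹ ∈ Q i l) → ∀ k,
      ∃ h, h ≠ 0 ∧ dem (Bv i) t k b h⁻¹ ∧ ∀ l ∈ W, dem (Bw l) t k (bw l) h := by
    intro i hi b hb0 hb k
    obtain ⟨h, hT, hh⟩ := fin_up W Bw t ht hw (fun l => (Q i l : Set K))
      (fun l hl => (hP i hi l hl).tinv) (fun l _ => one_mem (Q i l))
      (fun l _ a ha c hc => mul_mem (S := ValuationSubring K) ha hc)
      (fun k h => (∀ l ∈ W, b⁻¹ ∈ Q i l) → dem (Bv i) t k b h)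
      (fun k _ => dem_T0 ht k hb0)
      (fun k a c ha hc m hm hx => dem_T (hv i hi) k (ha hx) (hc hx) m hm)
      (by
        intro l hl β hβ0 hβ k
        obtain ⟨h, h0, hd, hd'⟩ := pair_dem ht (hP' i hi l hl) k hβ0 hb0 hβ (hb l hl)
        exact ⟨h, h0, hd, fun _ => hd'⟩)
      bw hbw0 (hbw i hi) k
    obtain ⟨l0, hl0⟩ := hW
    exact ⟨h⁻¹, inv_ne_zero (hh l0 hl0).1, by rw [inv_inv]; exact hT hb, fun l hl => (hh l hl).2⟩
  obtain ⟨h, hT, hh⟩ := fin_up V Bv t ht hv (fun i => {γ | ∀ l ∈ W, γ ∈ Q i l})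
    (fun i hi l hl => (hP i hi l hl).tinv) (fun i _ l _ => one_mem _)
    (fun i _ a ha c hc l hl => mul_mem (ha l hl) (hc l hl))
    (fun k h => ∀ l ∈ W, dem (Bw l) t k (bw l) h)
    (fun k l hl => dem_T0 ht k (hbw0 l hl))
    (fun k a c ha hc m hm l hl => dem_T (hw l hl) k (ha l hl) (hc l hl) m hm)
    (fun i hi b hb0 hb k => hfix i hi b hb0 hb k) bv hbv0 hbv k
  obtain ⟨i0, hi0⟩ := hV
  exact ⟨h, (hh i0 hi0).1, fun i hi => (hh i hi).2, hT⟩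

end
end
end PaperApprox

namespace PaperApprox
section
universe u
variable {K : Type u} [Field K]

section
variable {n : ℕ} {S : Fin n → Set (Set K)} {t : K} {f : Polynomial K}
    {B : Set K → Nrm K} {R : Set K → Set K → ValuationSubring K}

lemma sepLemma (D : Data S t f B R) {j : Fin n} (J : Finset (Fin n)) (hJ : j ∉ J)
    (hinf : (S j).Infinite → ∀ i ∈ J, (S i).Infinite) (hne : (S j).Nonempty)
    {b : Fin n → K} (hb0 : ∀ i, b i ≠ 0)
    (h1 : ∀ v ∈ S j, ∀ i ∈ J, ∀ w ∈ S i, (b j)⁻¹ ∈ R v w)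
    (h2 : ∀ v ∈ S j, ∀ i ∈ J, ∀ w ∈ S i, (b i)⁻¹ ∈ R v w)
    (l : Fin n) (hlJ : l ∈ J) (hl : (S l).Nonempty) :
    ∃ e, (∀ v ∈ S j, (B v).N (e - 1) < (B v).N (b j)) ∧
      ∀ i ∈ J, ∀ w ∈ S i, (B w).N e < (B w).N (b i) := by
  classical
  have hjne : ∀ i ∈ J, j ≠ i := by rintro i hi rfl; exact hJ hi
  obtain ⟨h, h0, hS, hT⟩ := stepA D (j := j) (J.filter fun i => (S i).Infinite)
    (fun h => hJ (Finset.mem_filter.1 h).1) (fun i hi => (Finset.mem_filter.1 hi).2) hne 3 hb0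
    (fun v hv i hi => h1 v hv i (Finset.mem_filter.1 hi).1)
    (fun v hv i hi => h2 v hv i (Finset.mem_filter.1 hi).1) l (hjne l hlJ) hl
    (fun v hv => h1 v hv l hlJ)
  have hEfin : {p : Fin n × Set K | p.1 ∈ J ∧ ¬ (S p.1).Infinite ∧ p.2 ∈ S p.1}.Finite := by
    refine Set.Finite.subset (Set.finite_iUnion
      (f := fun i => if (S i).Infinite then (∅ : Set (Fin n × Set K)) else Prod.mk i '' S i) ?_) ?_
    · intro i
      split_ifs with hi
      · exact Set.finite_empty
      · exact (Set.not_infinite.1 hi).image _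
    · rintro ⟨i, w⟩ ⟨_, hi, hw⟩
      refine Set.mem_iUnion.2 ⟨i, ?_⟩
      rw [if_neg hi]
      exact ⟨w, hw, rfl⟩
  have hq : ∃ q, (∀ v ∈ S j, dem (B v) t 3 (b j) q) ∧
      ∀ i ∈ J, ¬ (S i).Infinite → ∀ w ∈ S i,
        q ≠ 0 ∧ dem (B w) t 3 (b i) q⁻¹ ∧ dem (B w) t 3 h q⁻¹ := by
    by_cases hE : ∃ i ∈ J, ¬ (S i).Infinite ∧ (S i).Nonempty
    · obtain ⟨i0, hi0, hfin0, w0, hw0⟩ := hE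
      have hjfin : (S j).Finite := by
        by_contra hcon
        exact hfin0 (hinf hcon i0 hi0)
      have hbw : ∀ p : Fin n × Set K, ∃ β, β ≠ 0 ∧ (β = b p.1 ∨ β = h) ∧
          (B p.2).N β ≤ (B p.2).N (b p.1) ∧ (B p.2).N β ≤ (B p.2).N h := by
        intro p
        rcases le_total ((B p.2).N (b p.1)) ((B p.2).N h) with hle | hle
        · exact ⟨_, hb0 _, Or.inl rfl, le_rfl, hle⟩
        · exact ⟨_, h0, Or.inr rfl, hle, le_rfl⟩
      choose bw hbw0 hbwe hbw1 hbw2 using hbw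
      obtain ⟨r, hr0, hrv, hrw⟩ := stepB hjfin.toFinset hEfin.toFinset
        ⟨_, hjfin.mem_toFinset.2 hne.some_mem⟩ B (fun p => B p.2) (fun v p => R v p.2) D.t0
        (fun v hv => (D.good j v (hjfin.mem_toFinset.1 hv)).toTri)
        (fun p hp => (D.good p.1 p.2 (hEfin.mem_toFinset.1 hp).2.2).toTri)
        (fun v hv p hp => D.pair j p.1 (hjne _ (hEfin.mem_toFinset.1 hp).1) v
          (hjfin.mem_toFinset.1 hv) p.2 (hEfin.mem_toFinset.1 hp).2.2)
        (fun v hv p hp => D.pair' j p.1 (hjne _ (hEfin.mem_toFinset.1 hp).1) v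
          (hjfin.mem_toFinset.1 hv) p.2 (hEfin.mem_toFinset.1 hp).2.2)
        ⟨(i0, w0), hEfin.mem_toFinset.2 ⟨hi0, hfin0, hw0⟩⟩
        (fun _ => b j) bw (fun _ _ => hb0 j) (fun p _ => hbw0 p)
        (fun v hv p hp => h1 v (hjfin.mem_toFinset.1 hv) p.1 (hEfin.mem_toFinset.1 hp).1 p.2
          (hEfin.mem_toFinset.1 hp).2.2)
        (fun v hv p hp => by
          have hv' := hjfin.mem_toFinset.1 hv
          have hp' := hEfin.mem_toFinset.1 hp
          rcases hbwe p with he | he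
          · rw [he]; exact h2 v hv' p.1 hp'.1 p.2 hp'.2.2
          · rw [he]
            exact (D.pair j p.1 (hjne _ hp'.1) v hv' p.2 hp'.2.2).subv _
              (dem_lt (D.good j v hv').toTri (hS v hv')).1.le) 3
      refine ⟨r⁻¹, fun v hv => hrv v (hjfin.mem_toFinset.2 hv), fun i hi hfin w hw => ?_⟩
      have hd := hrw (i, w) (hEfin.mem_toFinset.2 ⟨hi, hfin, hw⟩)
      rw [inv_inv]
      refine ⟨inv_ne_zero hr0, ⟨hd.1, hd.2.trans_le ?_⟩, ⟨hd.1, hd.2.trans_le ?_⟩⟩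
      · have := hbw1 (i, w)
        gcongr
      · have := hbw2 (i, w)
        gcongr
    · push Not at hE
      refine ⟨0, fun v hv => dem_T0 D.t0 _ (hb0 j), fun i hi hfin w hw => ?_⟩
      have := hE i hi (Set.not_infinite.1 hfin)
      rw [this] at hw
      exact absurd hw (Set.notMem_empty _)
  obtain ⟨q, hqS, hqE⟩ := hq
  refine ⟨eElt f h (h * (1 + q)), fun v hv => S_est (D.good j v hv) h0 (hS v hv) (hqS v hv),
    fun i hi w hw => ?_⟩
  by_cases hiinf : (S i).Infinite
  · exact T_est (D.good i w hw) (D.good2 i hiinf w hw) h0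
      (hT i (Finset.mem_filter.2 ⟨hi, hiinf⟩) w hw) _
  · obtain ⟨hq0, hd1, hd2⟩ := hqE i hi hiinf w hw
    exact E_est (D.good i w hw) h0 hq0 hd1 hd2

/-- approximation on a finite subfamily -/
def Appr (S : Fin n → Set (Set K)) (t : K) (B : Set K → Nrm K) (x z : Fin n → K)
    (J : Finset (Fin n)) : Prop :=
  ∀ k : ℕ, ∃ a, ∀ i ∈ J, ∀ v ∈ S i, (B v).N (a - x i) < (B v).N (t ^ k * z i)

lemma appr_step (D : Data S t f B R) (x z : Fin n → K) (hz : ∀ i, z i ≠ 0)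
    (hI : ∀ i j, i ≠ j → ∀ v ∈ S i, ∀ w ∈ S j, (x j - x i) / z j ∈ R v w ∧ z j / z i ∈ R v w)
    {j : Fin n} (J : Finset (Fin n)) (hJ : j ∉ J)
    (hinf : (S j).Infinite → ∀ i ∈ J, (S i).Infinite) (hA : Appr S t B x z J) :
    Appr S t B x z (insert j J) := by
  intro k
  have hjne : ∀ i ∈ J, j ≠ i := by rintro i hi rfl; exact hJ hi
  have ht0 := D.t0
  have htk : ∀ m : ℕ, t ^ m ≠ 0 := fun m => pow_ne_zero m D.t0
  obtain ⟨a, ha⟩ := hA (k + 1)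
  have ha' : ∀ i ∈ J, ∀ v ∈ S i, (B v).N (a - x i) < (B v).N (t ^ k * z i) := by
    intro i hi v hv
    refine (ha i hi v hv).trans_le ?_
    rw [pow_succ', mul_assoc, map_mul]
    exact mul_le_of_le_one_left' (D.good i v hv).t1
  by_cases hne : (S j).Nonempty
  swap
  · refine ⟨a, fun i hi v hv => ?_⟩
    rcases Finset.mem_insert.1 hi with rfl | hi
    · exact absurd ⟨v, hv⟩ hne
    · exact ha' i hi v hv
  by_cases hl : ∃ l ∈ J, (S l).Nonempty
  swap
  · refine ⟨x j, fun i hi v hv => ?_⟩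
    rcases Finset.mem_insert.1 hi with rfl | hi
    · rw [sub_self, map_zero]
      exact N_pos _ (mul_ne_zero (htk k) (hz _))
    · exact absurd ⟨i, hi, v, hv⟩ hl
  obtain ⟨l, hlJ, hl⟩ := hl
  by_cases hc : x j - a = 0
  · refine ⟨a, fun i hi v hv => ?_⟩
    rcases Finset.mem_insert.1 hi with rfl | hi
    · rw [← neg_sub, hc, neg_zero, map_zero]
      exact N_pos _ (mul_ne_zero (htk k) (hz _))
    · exact ha' i hi v hv
  set c := x j - a with hcdef
  have hcz : ∀ v ∈ S j, ∀ i ∈ J, ∀ w ∈ S i, c / z i ∈ R v w := by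
    intro v hv i hi w hw
    have hp := D.pair j i (hjne i hi) v hv w hw
    have h1 := (hI j i (hjne i hi) v hv w hw).1
    have h2 : (a - x i) / z i ∈ R v w := by
      refine hp.subw _ ?_
      rw [map_div₀, div_le_one₀ (N_pos _ (hz i))]
      refine (ha i hi w hw).le.trans ?_
      rw [map_mul, map_pow]
      exact mul_le_of_le_one_left' (pow_le_one' (D.good i w hw).t1 _)
    have h3 := neg_mem (add_mem h1 h2)
    have : -((x i - x j) / z i + (a - x i) / z i) = c / z i := by rw [hcdef]; ring
    rwa [this] at h3
  have htp : ∀ v ∈ S j, ∀ i ∈ J, ∀ w ∈ S i, ∀ m : ℕ, (t ^ m)⁻¹ ∈ R v w := by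
    intro v hv i hi w hw m
    rw [← inv_pow]
    exact pow_mem (D.pair j i (hjne i hi) v hv w hw).tinv m
  classical
  set b : Fin n → K := fun i => (if i = j then t ^ k else t ^ (k + 1)) * z i / c with hb
  have hbj : b j = t ^ k * z j / c := by simp [hb]
  have hbi : ∀ i ∈ J, b i = t ^ (k + 1) * z i / c := by
    intro i hi
    simp [hb, (hjne i hi).symm]
  have hb0 : ∀ i, b i ≠ 0 := by
    intro i
    refine div_ne_zero (mul_ne_zero ?_ (hz i)) hc
    split_ifs
    · exact htk _
    · exact htk _
  obtain ⟨e, he1, he2⟩ := sepLemma D J hJ hinf hne hb0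
    (by
      intro v hv i hi w hw
      have h1 := mul_mem (mul_mem (htp v hv i hi w hw k) (hcz v hv i hi w hw))
        (hI j i (hjne i hi) v hv w hw).2
      convert h1 using 1
      rw [hbj]
      have := hz i; have := hz j; have := htk k
      field_simp)
    (by
      intro v hv i hi w hw
      have h1 := mul_mem (htp v hv i hi w hw (k + 1)) (hcz v hv i hi w hw)
      convert h1 using 1
      rw [hbi i hi]
      have := hz i; have := htk k
      field_simp) l hlJ hl
  refine ⟨a + e * c, fun i hi v hv => ?_⟩
  rcases Finset.mem_insert.1 hi with rfl | hi
  · have h1 := mul_lt_mul_of_pos_right (he1 v hv) (N_pos (B v) hc)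
    rw [← map_mul, ← map_mul, hbj, div_mul_cancel₀ _ hc] at h1
    convert h1 using 2
    rw [hcdef]; ring
  · have h1 := mul_lt_mul_of_pos_right (he2 i hi v hv) (N_pos (B v) hc)
    rw [← map_mul, ← map_mul, hbi i hi, div_mul_cancel₀ _ hc] at h1
    have h2 := (D.good i v hv).add _ _ _ (le_max_left ((B v).N (a - x i)) ((B v).N (e * c)))
      (le_max_right _ _)
    have h3 := h2.trans_lt (max_lt (ha i hi v hv) h1)
    rw [pow_succ', mul_assoc, map_mul _ t] at h3
    have h4 := lt_of_mul_lt_mul_left h3 zero_le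
    convert h4 using 2
    ring

lemma appr_all (D : Data S t f B R) (x z : Fin n → K) (hz : ∀ i, z i ≠ 0)
    (hI : ∀ i j, i ≠ j → ∀ v ∈ S i, ∀ w ∈ S j, (x j - x i) / z j ∈ R v w ∧ z j / z i ∈ R v w) :
    ∃ a, ∀ i, ∀ v ∈ S i, (B v).N (a - x i) < (B v).N (z i) := by
  classical
  have h1 : ∀ J : Finset (Fin n), (∀ i ∈ J, (S i).Infinite) → Appr S t B x z J := by
    intro J
    induction J using Finset.induction_on with
    | empty => intro _ k; exact ⟨0, by simp⟩
    | insert j J hJ ih =>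
      intro hinf
      exact appr_step D x z hz hI J hJ (fun _ i hi => hinf i (Finset.mem_insert_of_mem hi))
        (ih fun i hi => hinf i (Finset.mem_insert_of_mem hi))
  have h2 : ∀ J : Finset (Fin n), (∀ i ∈ J, ¬ (S i).Infinite) →
      Appr S t B x z (J ∪ Finset.univ.filter fun i => (S i).Infinite) := by
    intro J
    induction J using Finset.induction_on with
    | empty =>
      intro _
      rw [Finset.empty_union]
      exact h1 _ (fun i hi => (Finset.mem_filter.1 hi).2)
    | insert j J hJ ih =>
      intro hfin
      have hj := hfin j (Finset.mem_insert_self _ _)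
      rw [Finset.insert_union]
      refine appr_step D x z hz hI _ ?_ (fun h => absurd h hj)
        (ih fun i hi => hfin i (Finset.mem_insert_of_mem hi))
      rw [Finset.mem_union]
      rintro (h | h)
      · exact hJ h
      · exact hj (Finset.mem_filter.1 h).2
  obtain ⟨a, ha⟩ := h2 (Finset.univ.filter fun i => ¬ (S i).Infinite)
    (fun i hi => (Finset.mem_filter.1 hi).2) 0
  refine ⟨a, fun i v hv => ?_⟩
  have := ha i (by
    rw [Finset.mem_union, Finset.mem_filter, Finset.mem_filter]
    by_cases h : (S i).Infinite
    · exact Or.inr ⟨Finset.mem_univ _, h⟩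
    · exact Or.inl ⟨Finset.mem_univ _, h⟩) v hv
  simpa using this

end

lemma mball_iff {O : Set K} {B : Nrm K} (hB : ∀ x, x ∈ O ↔ B.N x ≤ 1) (x : K) :
    x ∈ mball O ↔ B.N x < 1 := by
  have hdef : x ∈ mball O ↔ x ∈ O ∧ ¬ (x ∈ O ∧ x ≠ 0 ∧ x⁻¹ ∈ O) := Iff.rfl
  rw [hdef, hB, hB, map_inv₀]
  by_cases hx : x = 0
  · simp [hx]
  · have h0 := N_pos B hx
    rw [inv_le_one₀ h0]
    constructor
    · rintro ⟨h1, h2⟩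
      by_contra hcon
      exact h2 ⟨h1, hx, not_lt.1 hcon⟩
    · intro h
      exact ⟨h.le, fun h2 => absurd h (not_lt.2 h2.2.2)⟩

lemma scale_iff {z : K} (hz : z ≠ 0) (A : Set K) (y : K) : y ∈ scale z A ↔ y / z ∈ A := by
  have hdef : y ∈ scale z A ↔ ∃ s ∈ A, y = z * s := Iff.rfl
  rw [hdef]
  constructor
  · rintro ⟨s, hs, rfl⟩
    rwa [mul_div_cancel_left₀ _ hz]
  · intro h
    exact ⟨_, h, (mul_div_cancel₀ _ hz).symm⟩

lemma scale_mball_iff {O : Set K} {B : Nrm K} (hB : ∀ x, x ∈ O ↔ B.N x ≤ 1) {z : K} (hz : z ≠ 0)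
    (y : K) : y ∈ scale z (mball O) ↔ B.N y < B.N z := by
  rw [scale_iff hz, mball_iff hB, map_div₀, div_lt_one₀ (N_pos B hz)]

lemma good_of {O : Set K} {B : Nrm K} (hB : ∀ x, x ∈ O ↔ B.N x ≤ 1) {t : K} (ht : t ≠ 0)
    {f : Polynomial K} (hd : 2 ≤ f.natDegree) (h1 : CondI f O) (h3 : CondIII t f O)
    (h4 : CondIV t O) : Good B t f := by
  have hadd1 : ∀ x y, B.N x ≤ 1 → B.N y ≤ 1 → B.N t * B.N (x + y) ≤ 1 := by
    intro x y hx hy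
    have h := h4 x ((hB x).2 hx) y ((hB y).2 hy)
    rw [scale_iff (inv_ne_zero ht), hB, div_inv_eq_mul, map_mul, mul_comm] at h
    exact h
  have haux : ∀ x y, B.N y ≤ B.N x → B.N t * B.N (x + y) ≤ B.N x := by
    intro x y hyx
    by_cases hx : x = 0
    · have hy : y = 0 := by
        by_contra hy
        rw [hx, map_zero] at hyx
        exact absurd (N_pos B hy) (not_lt.2 hyx)
      simp [hx, hy]
    · have h0 := N_pos B hx
      have h := hadd1 1 (y / x) (by simp) (by rwa [map_div₀, div_le_one₀ h0])
      calc B.N t * B.N (x + y) = (B.N t * B.N (1 + y / x)) * B.N x := by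
            rw [mul_assoc, ← map_mul B.N (1 + y / x), add_mul, one_mul, div_mul_cancel₀ _ hx]
        _ ≤ 1 * B.N x := by gcongr
        _ = _ := one_mul _
  have hiii : ∀ x, 1 < B.N x → x ∉ O := fun x hx h => absurd ((hB x).1 h) (not_le.2 hx)
  refine ⟨⟨ht, ?_, ?_⟩, hd, ?_, ?_, ?_, ?_⟩
  · simpa using hadd1 1 0 (by simp) (by simp)
  · intro x y c hx hy
    rcases le_total (B.N y) (B.N x) with h | h
    · exact (haux x y h).trans hx
    · rw [add_comm]; exact (haux y x h).trans hy
  · intro x hx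
    exact (hB _).1 (h1 x ((hB x).2 hx))
  · intro x hx
    obtain ⟨⟨s, ⟨_, hs⟩, he⟩, _⟩ := h3 x (hiii x hx)
    rw [scale_mball_iff hB ht, not_lt] at hs
    rw [he, map_mul, map_pow, mul_comm]
    gcongr
  · intro x hx
    obtain ⟨⟨s, ⟨hs, _⟩, he⟩, _⟩ := h3 x (hiii x hx)
    rw [hB] at hs
    rw [he, map_mul, map_pow]
    exact mul_le_of_le_one_right' hs
  · intro x hx
    obtain ⟨_, s, hs, he⟩ := h3 x (hiii x hx)
    rw [hB] at hs
    rw [he, add_sub_cancel_left, map_mul, map_pow]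
    exact mul_le_of_le_one_right' hs

lemma main_aux {K : Type u} [Field K] (n : ℕ)
    (S : Fin n → Set (Set K)) (hloc : ∀ i, ∀ v ∈ S i, IsLocality v)
    (t : K) (ht : t ≠ 0) (x z : Fin n → K) (hz : ∀ i, z i ≠ 0)
    (hU : AssumptionUExc S t)
    (hT : ∀ i, @IsCompact (Set K) (zarStarTop K) (S i))
    (hI : ∀ i j, ∀ W : Set K, IsValuationLocality W →
      (∃ v ∈ S i, v ⊆ W) → (∃ v ∈ S j, v ⊆ W) →
      x i - x j ∈ scale (z i) W ∧ scale (z i) W = scale (z j) W)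
    (hti : ∀ i j, i ≠ j → SetTIndep t (S i) (S j))
    (hinc : ∀ i j, i ≠ j → SetIncomp (S i) (S j)) :
    ∃ a : K, ∀ i, ∀ v ∈ S i, a - x i ∈ scale (z i) (mball v) := by
  classical
  obtain ⟨f, hd, hf, hf2⟩ := hU
  by_cases hnone : ∃ i, (S i).Nonempty
  swap
  · exact ⟨0, fun i v hv => absurd ⟨i, v, hv⟩ hnone⟩
  obtain ⟨i0, v0, hv0⟩ := hnone
  have hex : ∀ v : Set K, ∃ B : Nrm K, IsLocality v → ∀ x, x ∈ v ↔ B.N x ≤ 1 := by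
    intro v
    by_cases hv : IsLocality v
    · obtain ⟨B, hB⟩ := exists_nrm hv
      exact ⟨B, fun _ => hB⟩
    · obtain ⟨B, hB⟩ := exists_nrm (hloc i0 v0 hv0)
      exact ⟨B, fun h => absurd h hv⟩
  choose B hB using hex
  have hBS : ∀ i, ∀ v ∈ S i, ∀ x, x ∈ v ↔ (B v).N x ≤ 1 := fun i v hv => hB v (hloc i v hv)
  have hexR : ∀ v w : Set K, ∃ A : ValuationSubring K, ∀ i j, i ≠ j → v ∈ S i → w ∈ S j →
      (A : Set K) = prodSet v w ∧ IsFCC v w A := by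
    intro v w
    by_cases h : ∃ i j, i ≠ j ∧ v ∈ S i ∧ w ∈ S j
    · obtain ⟨i, j, hij, hv, hw⟩ := h
      obtain ⟨A, hA⟩ := prod_fcc (hloc i v hv) (hloc j w hw) (hinc i j hij v hv w hw)
        (hti i j hij v hv w hw).2
      exact ⟨A, fun _ _ _ _ _ => hA⟩
    · exact ⟨⊤, fun i j hij hv hw => absurd ⟨i, j, hij, hv, hw⟩ h⟩
  choose R hR using hexR
  have hsub : ∀ i j, i ≠ j → ∀ v ∈ S i, ∀ w ∈ S j, v ⊆ (R v w : Set K) ∧ w ⊆ (R v w : Set K) := by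
    intro i j hij v hv w hw
    have h := (hR v w i j hij hv hw).2
    exact ⟨h.2.1, h.2.2.1⟩
  have D : Data S t f B R := by
    refine ⟨ht, ?_, ?_, hT, ?_, ?_, ?_⟩
    · intro i v hv
      obtain ⟨h1, h3, h4⟩ := hf i v hv
      exact good_of (hBS i v hv) ht hd h1 h3 h4
    · intro i hi v hv y hy
      have := hf2 i hi v hv y ((hBS i v hv y).2 hy)
      rwa [scale_mball_iff (hBS i v hv) ht, not_lt] at this
    · intro k b h hb
      have ht1 : t ^ (k + 1) ≠ 0 := pow_ne_zero _ ht
      refine ⟨{O | h / t ^ (k + 1) ∈ mball O} ∩ {O | h / (t ^ (k + 1) * b) ∈ mball O}, ?_, ?_⟩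
      · let _ := zarStarTop K
        exact IsOpen.inter (TopologicalSpace.isOpen_generateFrom_of_mem ⟨_, rfl⟩)
          (TopologicalSpace.isOpen_generateFrom_of_mem ⟨_, rfl⟩)
      · intro i v hv
        have hdef : v ∈ ({O | h / t ^ (k + 1) ∈ mball O} ∩
            {O | h / (t ^ (k + 1) * b) ∈ mball O} : Set (Set K)) ↔
            h / t ^ (k + 1) ∈ mball v ∧ h / (t ^ (k + 1) * b) ∈ mball v := Iff.rfl
        rw [hdef, mball_iff (hBS i v hv), mball_iff (hBS i v hv), map_div₀, map_div₀,
          div_lt_one₀ (N_pos _ ht1), div_lt_one₀ (N_pos _ (mul_ne_zero ht1 hb)), map_mul, map_pow,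
          dem]
    · intro i j hij v hv w hw
      obtain ⟨hA, hfcc⟩ := hR v w i j hij hv hw
      have hs := hsub i j hij v hv w hw
      have htt := (hti i j hij v hv w hw).1 _ hfcc
      refine ⟨fun y hy => hs.1 ((hBS i v hv y).2 hy), fun y hy => hs.2 ((hBS j w hw y).2 hy),
        htt.1, htt.2, fun c hc => ?_⟩
      refine pair_sep (hloc i v hv) (hloc j w hw) (hinc i j hij v hv w hw) (hBS i v hv)
        (hBS j w hw) ?_
      rw [← hA]; exact hc
    · intro i j hij v hv w hw
      obtain ⟨hA, hfcc⟩ := hR v w i j hij hv hw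
      have hs := hsub i j hij v hv w hw
      have htt := (hti i j hij v hv w hw).1 _ hfcc
      refine ⟨fun y hy => hs.2 ((hBS j w hw y).2 hy), fun y hy => hs.1 ((hBS i v hv y).2 hy),
        htt.1, htt.2, fun c hc => ?_⟩
      refine pair_sep (hloc j w hw) (hloc i v hv) (hinc j i hij.symm w hw v hv) (hBS j w hw)
        (hBS i v hv) ?_
      rw [prodSet_comm, ← hA]; exact hc
  obtain ⟨a, ha⟩ := appr_all D x z hz (by
    intro i j hij v hv w hw
    have hs := hsub i j hij v hv w hw
    obtain ⟨h1, h2⟩ := hI j i (R v w : Set K) ⟨R v w, rfl⟩ ⟨w, hw, hs.2⟩ ⟨v, hv, hs.1⟩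
    refine ⟨(scale_iff (hz j) _ _).1 h1, ?_⟩
    have h3 : z j ∈ scale (z i) (R v w : Set K) := by
      rw [← h2, scale_iff (hz j), div_self (hz j)]
      exact one_mem (R v w)
    exact (scale_iff (hz i) _ _).1 h3)
  exact ⟨a, fun i v hv => (scale_mball_iff (hBS i v hv) (hz i) _).2 (ha i v hv)⟩

end
end PaperApprox

namespace PaperApprox

variable {K : Type*} [Field K]

/-- **Theorem 6.4, Situation `m`** (approximation with finitely many exceptional
localities, strict version). -/
theorem main_theorem_exceptional_strict {K : Type*} [Field K] (n : ℕ)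
    (S : Fin n → Set (Set K)) (hloc : ∀ i, ∀ v ∈ S i, IsLocality v)
    (t : K) (ht : t ≠ 0) (x z : Fin n → K) (hz : ∀ i, z i ≠ 0)
    (hU : AssumptionUExc S t)
    (hT : ∀ i, @IsCompact (Set K) (zarStarTop K) (S i))
    (hI : ∀ i j, ∀ W : Set K, IsValuationLocality W →
      (∃ v ∈ S i, v ⊆ W) → (∃ v ∈ S j, v ⊆ W) →
      x i - x j ∈ scale (z i) W ∧ scale (z i) W = scale (z j) W)
    (hti : ∀ i j, i ≠ j → SetTIndep t (S i) (S j))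
    (hinc : ∀ i j, i ≠ j → SetIncomp (S i) (S j)) :
    ∃ a : K, ∀ i, ∀ v ∈ S i, a - x i ∈ scale (z i) (mball v) :=
  main_aux n S hloc t ht x z hz hU hT hI hti hinc

end PaperApprox
end
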